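/- arXiv:1912.05256 — 4 statements merged into one kernel-verified Lean document; each statement's English description precedes it below -/
import Mathlib

section
/- There exists a field extension K of F with [K:F] = 3 such that the K-algebra 𝒮 ⊗_F K is isomorphic to the direct product of nine copies of K with the matrix algebra M₃(K), i.e. 𝒮 ⊗_F K ≅ K^⊕9 × M₃(K); in particular dim_F 𝒮 = 18. -/
open scoped TensorProduct

set_option synthInstance.maxHeartbeats 1000000
set_option maxHeartbeats 1000000

/-- A two-element family of types, used to form binary free products. -/
def fam (A B : Type) : Bool → Type
  | true => A
  | false => B

instance famSemiring (A B : Type) [Semiring A] [Semiring B] : ∀ b, Semiring (fam A B b)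
  | true => ‹Semiring A›
  | false => ‹Semiring B›

instance famAlgebra (k A B : Type) [CommSemiring k] [Semiring A] [Semiring B]
    [Algebra k A] [Algebra k B] : ∀ b, Algebra k (fam A B b)
  | true => ‹Algebra k A›
  | false => ‹Algebra k B›

/-- The free product (coproduct in the category of unital associative `k`-algebras)
`A * B` of two `k`-algebras. -/
abbrev FP (k A B : Type) [CommSemiring k] [Semiring A] [Semiring B]
    [Algebra k A] [Algebra k B] : Type :=
  LinearAlgebra.FreeProduct k (fam A B)

/-- The canonical map `A →ₐ[k] A * B`. -/
noncomputable def inl (k A B : Type) [CommSemiring k] [Semiring A] [Semiring B]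
    [Algebra k A] [Algebra k B] : A →ₐ[k] FP k A B :=
  LinearAlgebra.FreeProduct.ι k (fam A B) true

/-- The canonical map `B →ₐ[k] A * B`. -/
noncomputable def inr (k A B : Type) [CommSemiring k] [Semiring A] [Semiring B]
    [Algebra k A] [Algebra k B] : B →ₐ[k] FP k A B :=
  LinearAlgebra.FreeProduct.ι k (fam A B) false

/-- The field `F = k(y₁,y₂,y₃)` of rational functions in three variables over `k`. -/
abbrev Ffield (k : Type) [Field k] : Type := FractionRing (MvPolynomial (Fin 3) k)

/-- The variable `yᵢ`, viewed as an element of `F = k(y₁,y₂,y₃)`. -/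
noncomputable def yvar (k : Type) [Field k] (i : Fin 3) : Ffield k :=
  algebraMap (MvPolynomial (Fin 3) k) (Ffield k) (MvPolynomial.X i)

/-- The image in `𝒜 * ℬ` of the `i`-th standard primitive idempotent of `𝒜 = F^⊕3`. -/
noncomputable def pgen (k : Type) [Field k] (i : Fin 3) :
    FP (Ffield k) (Fin 3 → Ffield k) (Fin 3 → Ffield k) :=
  inl (Ffield k) (Fin 3 → Ffield k) (Fin 3 → Ffield k) (Pi.single i 1)

/-- The image in `𝒜 * ℬ` of the `i`-th standard primitive idempotent of `ℬ = F^⊕3`. -/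
noncomputable def qgen (k : Type) [Field k] (i : Fin 3) :
    FP (Ffield k) (Fin 3 → Ffield k) (Fin 3 → Ffield k) :=
  inr (Ffield k) (Fin 3 → Ffield k) (Fin 3 → Ffield k) (Pi.single i 1)

/-- The element `X = [p₁,q₁] + y₁[p₁,q₂] + y₂[p₂,q₁] + y₃[p₂,q₂]` of `𝒜 * ℬ`. -/
noncomputable def Xrel (k : Type) [Field k] :
    FP (Ffield k) (Fin 3 → Ffield k) (Fin 3 → Ffield k) :=
  (pgen k 0 * qgen k 0 - qgen k 0 * pgen k 0)
    + yvar k 0 • (pgen k 0 * qgen k 1 - qgen k 1 * pgen k 0)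
    + yvar k 1 • (pgen k 1 * qgen k 0 - qgen k 0 * pgen k 1)
    + yvar k 2 • (pgen k 1 * qgen k 1 - qgen k 1 * pgen k 1)

/-- The `F`-algebra `𝒮`: the quotient of `𝒜 * ℬ = F^⊕3 * F^⊕3` by the two-sided ideal
generated by `X`. -/
noncomputable abbrev Salg (k : Type) [Field k] : Type :=
  @RingQuot (FP (Ffield k) (Fin 3 → Ffield k) (Fin 3 → Ffield k)) Ring.toSemiring
    (fun u v => u = Xrel k ∧ v = 0)


/-- Scalars of the three-dimensional representation in which `pᵢ` is the diagonal matrix unit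
`Eᵢᵢ`, `e` has entries `w j` and `f` has entries `c * u i * u j * w j`. -/
structure RepScalars {F : Type*} [Field F] (c : F) (u w : Fin 3 → F) : Prop where
  u_inj : Function.Injective u
  u_prod : c * (u 0 * u 1 * u 2) = 1
  w_ne : ∀ i, w i ≠ 0
  w_eq : ∀ i j k, i ≠ j → i ≠ k → j ≠ k →
    c * w k * ((u k - u i) * (u k - u j)) = 1 + c * (u i * u j)
  sum_w : ∑ i, w i = 1
  sum_uw : ∑ i, u i * w i = 0
  sum_uuw : c * ∑ i, u i * u i * w i = 1

/-- `p` is a complete family of three orthogonal idempotents, `e` and `f` are orthogonal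
idempotents, and the off-diagonal Peirce components of `f` are multiples of those of `e`. -/
structure PeirceRel {F R : Type*} [Field F] [Ring R] [Algebra F R]
    (c : F) (u : Fin 3 → F) (p : Fin 3 → R) (e f : R) : Prop where
  p_mul : ∀ i j, p i * p j = if i = j then p i else 0
  p_sum : ∑ i, p i = 1
  ee : e * e = e
  ff : f * f = f
  ef : e * f = 0
  fe : f * e = 0
  off : ∀ i j, i ≠ j → p i * f * p j = (c * (u i * u j)) • (p i * e * p j)

theorem Fin.sum_three_of_ne {M : Type*} [AddCommMonoid M] (g : Fin 3 → M) {i j k : Fin 3}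
    (hij : i ≠ j) (hik : i ≠ k) (hjk : j ≠ k) : ∑ l, g l = g i + g j + g k := by
  have h : (Finset.univ : Finset (Fin 3)) = {i, j, k} := by
    revert hij hik hjk; revert i j k; decide
  rw [h, Finset.sum_insert (by simp [hij, hik]), Finset.sum_insert (by simp [hjk]),
    Finset.sum_singleton, add_assoc]

theorem Fin.exists_third {i j : Fin 3} (hij : i ≠ j) : ∃ k, i ≠ k ∧ j ≠ k := by
  revert i j; decide

namespace RepScalars

variable {F : Type*} [Field F] {c : F} {u w : Fin 3 → F}

theorem c_ne (h : RepScalars c u w) : c ≠ 0 := by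
  rintro rfl; simpa using h.u_prod

theorem u_ne (h : RepScalars c u w) (i : Fin 3) : u i ≠ 0 := by
  have := h.u_prod
  intro hi
  fin_cases i <;> simp_all

end RepScalars

namespace PeirceRel

variable {F R : Type*} [Field F] [Ring R] [Algebra F R]
  {c : F} {u w : Fin 3 → F} {p : Fin 3 → R} {e f : R}

theorem p_idem (h : PeirceRel c u p e f) (i : Fin 3) : p i * p i = p i := by
  simp [h.p_mul]

theorem sum_mul_mul (h : PeirceRel c u p e f) (x y : R) : ∑ l, x * p l * y = x * y := by
  rw [← Finset.sum_mul, ← Finset.mul_sum, h.p_sum, mul_one]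

theorem off_right (h : PeirceRel c u p e f) (x : R) {i j : Fin 3} (hij : i ≠ j) :
    x * p i * f * p j = (c * (u i * u j)) • (x * p i * e * p j) := by
  have := congrArg (x * ·) (h.off i j hij)
  simpa only [mul_assoc, mul_smul_comm] using this

/-- The four relations between the components of `p i * R * p j` for `i ≠ j`. -/
theorem offDiag_relations (h : PeirceRel c u p e f) {i j k : Fin 3}
    (hij : i ≠ j) (hik : i ≠ k) (hjk : j ≠ k) :
    p i * e * p i * e * p j + p i * e * p j * e * p j + p i * e * p k * e * p j
        = p i * e * p j ∧
    (c * (u i * u j)) • (p i * f * p i * e * p j) + (c * (u i * u j)) • (p i * e * p j * f * p j)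
        + ((c * (u i * u k)) * (c * (u k * u j))) • (p i * e * p k * e * p j)
        = (c * (u i * u j)) • (p i * e * p j) ∧
    (c * (u i * u j)) • (p i * e * p i * e * p j) + p i * e * p j * f * p j
        + (c * (u k * u j)) • (p i * e * p k * e * p j) = 0 ∧
    p i * f * p i * e * p j + (c * (u i * u j)) • (p i * e * p j * e * p j)
        + (c * (u i * u k)) • (p i * e * p k * e * p j) = 0 := by
  have key (x y : R) : p i * x * p i * y * p j + p i * x * p j * y * p j
      + p i * x * p k * y * p j = p i * (x * y) * p j := by
    have := h.sum_mul_mul (p i * x) (y * p j)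
    rw [Fin.sum_three_of_ne _ hij hik hjk] at this
    simpa only [mul_assoc] using this
  refine ⟨?_, ?_, ?_, ?_⟩
  · simpa only [h.ee] using key e e
  · have := key f f
    rw [h.off_right _ hij, h.off_right _ hjk.symm, h.off i k hik, h.off i j hij, h.ff,
      h.off i j hij] at this
    simpa only [smul_mul_assoc, smul_smul, mul_comm (c * (u k * u j))] using this
  · have := key e f
    rw [h.off_right _ hij, h.off_right _ hjk.symm, h.ef] at this
    simpa using this
  · have := key f e
    rw [h.off i k hik, h.off i j hij, h.fe] at this
    simpa using this

theorem mul_third (h : PeirceRel c u p e f) (hs : RepScalars c u w) {i j k : Fin 3}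
    (hij : i ≠ j) (hik : i ≠ k) (hjk : j ≠ k) :
    p i * e * p k * e * p j = w k • (p i * e * p j) := by
  obtain ⟨h1, h2, h3, h4⟩ := h.offDiag_relations hij hik hjk
  have hN : c * c * (u i * u j) * ((u k - u i) * (u k - u j)) ≠ 0 := by
    have h1 := sub_ne_zero.2 (hs.u_inj.ne hik.symm)
    have h2 := sub_ne_zero.2 (hs.u_inj.ne hjk.symm)
    have := hs.c_ne
    have := hs.u_ne i
    have := hs.u_ne j
    positivity
  refine smul_right_injective R hN ?_
  have hw : c * c * (u i * u j) * ((u k - u i) * (u k - u j)) * w k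
      = (c * (u i * u j)) * (1 + c * (u i * u j)) := by
    rw [← hs.w_eq i j k hij hik hjk]; ring
  dsimp only
  rw [smul_smul, hw]
  linear_combination (norm := module) (-(c * (u i * u j)) : F) • h3 - (c * (u i * u j)) • h4 + h2
    + (c * (u i * u j)) ^ 2 • h1

theorem diag_mul (h : PeirceRel c u p e f) (hs : RepScalars c u w) (h2 : (2 : F) ≠ 0)
    {i j : Fin 3} (hij : i ≠ j) :
    p i * e * p i * e * p j = w i • (p i * e * p j) := by
  obtain ⟨k, hik, hjk⟩ := Fin.exists_third hij
  have hsw := hs.sum_w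
  rw [Fin.sum_three_of_ne _ hij hik hjk] at hsw
  have e1 := (h.offDiag_relations hij hik hjk).1
  have e2 := congrArg (· * e * p j) (h.offDiag_relations hik hij hjk.symm).1
  have e3 := congrArg (p i * e * ·) (h.offDiag_relations hjk.symm hik.symm hij.symm).1
  have t1 := h.mul_third hs hij hik hjk
  have t2 := congrArg (· * e * p j) (h.mul_third hs hik hij hjk.symm)
  have t3 := congrArg (p i * e * ·) (h.mul_third hs hjk.symm hik.symm hij.symm)
  have t4 := congrArg (p i * e * ·) t1
  have t5 := congrArg (· * e * p j) t1
  simp only [add_mul, mul_add, smul_mul_assoc, mul_smul_comm, ← mul_assoc] at e1 e2 e3 t1 t2 t3 t4 t5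
  rw [t2, t4, t1] at e2
  rw [t3, t5, t1] at e3
  refine smul_right_injective R (mul_ne_zero h2 (hs.w_ne k)) ?_
  dsimp only
  have hw : w i = 1 - w j - w k := by linear_combination hsw
  rw [t1] at e1
  have hw' : (2 * w k) • w i • (p i * e * p j)
    = (w k * (1 - w j + w i - w k)) • (p i * e * p j) := by
    rw [smul_smul]; congr 1; rw [hw]; ring
  rw [hw']
  linear_combination (norm := module) (w k) • e1 + e2 - e3

theorem mul_e_mul_e (h : PeirceRel c u p e f) (hs : RepScalars c u w) (h2 : (2 : F) ≠ 0)
    {i j : Fin 3} (hij : i ≠ j) (l : Fin 3) :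
    p i * e * p l * e * p j = w l • (p i * e * p j) := by
  by_cases hil : i = l
  · subst hil; exact h.diag_mul hs h2 hij
  obtain ⟨k, hik, hjk⟩ := Fin.exists_third hij
  by_cases hjl : j = l
  · subst hjl
    have h1 := (h.offDiag_relations hij hik hjk).1
    rw [h.diag_mul hs h2 hij, h.mul_third hs hij hik hjk] at h1
    have hsw := hs.sum_w
    rw [Fin.sum_three_of_ne _ hij hik hjk] at hsw
    have hw : w j = 1 - w i - w k := by linear_combination hsw
    rw [hw]
    linear_combination (norm := module) h1
  · exact h.mul_third hs hij hil hjl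

theorem diag_f_mul_e (h : PeirceRel c u p e f) (hs : RepScalars c u w) (h2 : (2 : F) ≠ 0)
    {i j : Fin 3} (hij : i ≠ j) :
    p i * f * p i * e * p j = (c * (u i * u i) * w i) • (p i * e * p j) := by
  obtain ⟨k, hik, hjk⟩ := Fin.exists_third hij
  have h1 := (h.offDiag_relations hij hik hjk).2.2.2
  rw [h.mul_e_mul_e hs h2 hij, h.mul_e_mul_e hs h2 hij] at h1
  have hsw := hs.sum_uw
  rw [Fin.sum_three_of_ne _ hij hik hjk] at hsw
  have hw : c * (u i * u i) * w i = -(c * u i * (u j * w j + u k * w k)) := by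
    linear_combination c * u i * hsw
  rw [hw]
  linear_combination (norm := module) h1

theorem diag_e_mul_f (h : PeirceRel c u p e f) (hs : RepScalars c u w) (h2 : (2 : F) ≠ 0)
    {i j : Fin 3} (hij : i ≠ j) :
    p i * e * p j * f * p j = (c * (u j * u j) * w j) • (p i * e * p j) := by
  obtain ⟨k, hik, hjk⟩ := Fin.exists_third hij
  have h1 := (h.offDiag_relations hij hik hjk).2.2.1
  rw [h.mul_e_mul_e hs h2 hij, h.mul_e_mul_e hs h2 hij] at h1
  have hsw := hs.sum_uw
  rw [Fin.sum_three_of_ne _ hij hik hjk] at hsw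
  have hw : c * (u j * u j) * w j = -(c * u j * (u i * w i + u k * w k)) := by
    linear_combination c * u j * hsw
  rw [hw]
  linear_combination (norm := module) h1

/-- The multiple of the matrix unit `Eᵢᵢ` in `p i * R * p i`. -/
theorem loop_eq (h : PeirceRel c u p e f) (hs : RepScalars c u w) {i j k : Fin 3}
    (hij : i ≠ j) (hik : i ≠ k) (hjk : j ≠ k) :
    w k • (p i * e * p j * e * p i) = w j • (p i * e * p k * e * p i) := by
  have t1 := congrArg (· * e * p i) (h.mul_third hs hij hik hjk)
  have t2 := congrArg (p i * e * ·) (h.mul_third hs hik.symm hjk.symm hij)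
  simp only [smul_mul_assoc, mul_smul_comm, ← mul_assoc] at t1 t2
  rw [← t1, t2]

/-- A family of eighteen elements spanning any algebra generated by `p`, `e` and `f`. -/
def spanningFamily (w : Fin 3 → F) (p : Fin 3 → R) (e f : R) (x : Fin 3 × Fin 6) : R :=
  let i := x.1
  ![p i, p i * e * p i, p i * f * p i, (w (i + 1))⁻¹ • (p i * e * p (i + 1) * e * p i),
    p i * e * p (i + 1), p i * e * p (i + 2)] x.2

theorem e_mem (i j : Fin 3) :
    p i * e * p j ∈ Submodule.span F (Set.range (spanningFamily w p e f)) := by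
  have h : j = i ∨ j = i + 1 ∨ j = i + 2 := by revert i j; decide
  rcases h with rfl | rfl | rfl
  · exact Submodule.subset_span ⟨(j, 1), rfl⟩
  · exact Submodule.subset_span ⟨(i, 4), rfl⟩
  · exact Submodule.subset_span ⟨(i, 5), rfl⟩

theorem f_mem (h : PeirceRel c u p e f) (i j : Fin 3) :
    p i * f * p j ∈ Submodule.span F (Set.range (spanningFamily w p e f)) := by
  by_cases hij : i = j
  · subst hij; exact Submodule.subset_span ⟨(i, 2), rfl⟩
  · rw [h.off i j hij]; exact Submodule.smul_mem _ _ (e_mem i j)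

theorem loop_eq_smul (h : PeirceRel c u p e f) (hs : RepScalars c u w) {i j : Fin 3}
    (hij : i ≠ j) :
    p i * e * p j * e * p i = w j • spanningFamily w p e f (i, 3) := by
  have h3 : spanningFamily w p e f (i, 3) =
    (w (i + 1))⁻¹ • (p i * e * p (i + 1) * e * p i) := rfl
  rw [h3, smul_smul]
  have hw := hs.w_ne (i + 1)
  by_cases hj : j = i + 1
  · subst hj; rw [mul_inv_cancel₀ hw, one_smul]
  · have hi : i ≠ i + 1 := (by decide : ∀ i : Fin 3, i ≠ i + 1) i
    have := h.loop_eq hs hij hi hj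
    rw [mul_comm, mul_smul, ← this, smul_smul, inv_mul_cancel₀ hw, one_smul]

theorem loop_mem (h : PeirceRel c u p e f) (hs : RepScalars c u w) {i j : Fin 3}
    (hij : i ≠ j) :
    p i * e * p j * e * p i ∈ Submodule.span F (Set.range (spanningFamily w p e f)) := by
  rw [h.loop_eq_smul hs hij]
  exact Submodule.smul_mem _ _ (Submodule.subset_span ⟨(i, 3), rfl⟩)

/-- Every product `p i * x * p l * y * p j` with `x, y ∈ {e, f}` lies in the span. -/
theorem two_step_mem (h : PeirceRel c u p e f) (hs : RepScalars c u w) (h2 : (2 : F) ≠ 0)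
    {x y : R} (hx : x = e ∨ x = f) (hy : y = e ∨ y = f) (i l j : Fin 3) :
    p i * x * p l * y * p j ∈ Submodule.span F (Set.range (spanningFamily w p e f)) := by
  have off {i l j : Fin 3} (hne : i ≠ j ∨ i ≠ l) :
      p i * x * p l * y * p j ∈ Submodule.span F (Set.range (spanningFamily w p e f)) := by
    by_cases hil : i = l
    · subst hil
      have hij : i ≠ j := by tauto
      have hy' : ∃ s : F, p i * x * p i * y * p j = s • (p i * x * p i * e * p j) := by
        rcases hy with rfl | rfl
        · exact ⟨1, (one_smul _ _).symm⟩
        · exact ⟨_, h.off_right _ hij⟩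
      obtain ⟨s, hs'⟩ := hy'
      rw [hs']
      refine Submodule.smul_mem _ _ ?_
      rcases hx with rfl | rfl
      · rw [h.mul_e_mul_e hs h2 hij]
        exact Submodule.smul_mem _ _ (e_mem i j)
      · rw [h.diag_f_mul_e hs h2 hij]
        exact Submodule.smul_mem _ _ (e_mem i j)
    · have hx' : ∃ s : F, p i * x * p l * y * p j = s • (p i * e * p l * y * p j) := by
        rcases hx with rfl | rfl
        · exact ⟨1, (one_smul _ _).symm⟩
        · exact ⟨_, by rw [h.off i l hil]; simp only [smul_mul_assoc]; rfl⟩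
      obtain ⟨s, hs'⟩ := hx'
      rw [hs']
      refine Submodule.smul_mem _ _ ?_
      by_cases hlj : l = j
      · subst hlj
        rcases hy with rfl | rfl
        · rw [h.mul_e_mul_e hs h2 hil]
          exact Submodule.smul_mem _ _ (e_mem i l)
        · rw [h.diag_e_mul_f hs h2 hil]
          exact Submodule.smul_mem _ _ (e_mem i l)
      · have hy' : ∃ s : F, p i * e * p l * y * p j = s • (p i * e * p l * e * p j) := by
          rcases hy with rfl | rfl
          · exact ⟨1, (one_smul _ _).symm⟩
          · exact ⟨_, h.off_right _ hlj⟩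
        obtain ⟨s, hs''⟩ := hy'
        rw [hs'']
        refine Submodule.smul_mem _ _ ?_
        by_cases hij : i = j
        · subst hij
          exact h.loop_mem hs hil
        · rw [h.mul_e_mul_e hs h2 hij]
          exact Submodule.smul_mem _ _ (e_mem i j)
  by_cases hne : i ≠ j ∨ i ≠ l
  · exact off hne
  · obtain ⟨rfl, rfl⟩ : i = j ∧ i = l := by tauto
    obtain ⟨m, him⟩ := (by decide : ∀ i : Fin 3, ∃ m, i ≠ m) i
    obtain ⟨k, hik, hmk⟩ := Fin.exists_third him
    have key := h.sum_mul_mul (p i * x) (y * p i)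
    rw [Fin.sum_three_of_ne _ him hik hmk] at key
    have hxy : p i * (x * y) * p i ∈
        Submodule.span F (Set.range (spanningFamily w p e f)) := by
      rcases hx with rfl | rfl <;> rcases hy with rfl | rfl
      · rw [h.ee]; exact e_mem i i
      · rw [h.ef]; simp
      · rw [h.fe]; simp
      · rw [h.ff]; exact h.f_mem i i
    have key' : p i * x * p i * y * p i = p i * (x * y) * p i
        - p i * x * p m * y * p i - p i * x * p k * y * p i := by
      rw [eq_sub_iff_add_eq, eq_sub_iff_add_eq]
      simp only [← mul_assoc] at key ⊢
      rw [← key]; abel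
    rw [key']
    exact sub_mem (sub_mem hxy (off (Or.inr him))) (off (Or.inr hik))

theorem mul_loop_mem (h : PeirceRel c u p e f) (hs : RepScalars c u w) (h2 : (2 : F) ≠ 0)
    {x : R} (hx : x = e ∨ x = f) (l i : Fin 3) :
    p l * x * spanningFamily w p e f (i, 3)
      ∈ Submodule.span F (Set.range (spanningFamily w p e f)) := by
  have hli {l : Fin 3} (hli : l ≠ i) : p l * e * spanningFamily w p e f (i, 3)
      = w i • (p l * e * p i) := by
    obtain ⟨k, hlk, hik⟩ := Fin.exists_third hli
    refine smul_right_injective R (hs.w_ne k) ?_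
    dsimp only
    rw [← mul_smul_comm, ← h.loop_eq_smul hs hik]
    have t1 := h.mul_third hs hlk hli hik.symm
    simp only [← mul_assoc]
    rw [t1, smul_mul_assoc, smul_mul_assoc, h.mul_third hs hli hlk hik, smul_comm]
  by_cases hl : l = i
  · subst hl
    obtain ⟨m, hm⟩ := (by decide : ∀ l : Fin 3, ∃ m, l ≠ m) l
    have hx' : ∃ s : F, p l * x * p l * e * p m = s • (p l * e * p m) := by
      rcases hx with rfl | rfl
      · exact ⟨_, h.mul_e_mul_e hs h2 hm l⟩
      · exact ⟨_, h.diag_f_mul_e hs h2 hm⟩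
    obtain ⟨s, hs'⟩ := hx'
    rw [← Submodule.smul_mem_iff _ (hs.w_ne m), ← mul_smul_comm, ← h.loop_eq_smul hs hm]
    simp only [← mul_assoc]
    rw [hs', smul_mul_assoc, smul_mul_assoc]
    exact Submodule.smul_mem _ _ (h.loop_mem hs hm)
  · rcases hx with rfl | rfl
    · rw [hli hl]; exact Submodule.smul_mem _ _ (e_mem l i)
    · have h3 : spanningFamily w p e x (i, 3) = p i * spanningFamily w p e x (i, 3) := by
        simp only [spanningFamily]
        simp [← mul_assoc, h.p_idem]
      rw [h3, ← mul_assoc, h.off l i hl, smul_mul_assoc, mul_assoc, ← h3, hli hl]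
      exact Submodule.smul_mem _ _ (Submodule.smul_mem _ _ (e_mem l i))

theorem p_mul_mem (h : PeirceRel c u p e f) (i : Fin 3) {x : R}
    (hx : x ∈ Submodule.span F (Set.range (spanningFamily w p e f))) :
    p i * x ∈ Submodule.span F (Set.range (spanningFamily w p e f)) := by
  induction hx using Submodule.span_induction with
  | mem x hx =>
    obtain ⟨⟨j, a⟩, rfl⟩ := hx
    have h3 : p i * spanningFamily w p e f (j, a)
        = if i = j then spanningFamily w p e f (j, a) else 0 := by
      split_ifs with hij
      · subst hij
        fin_cases a <;> simp [spanningFamily, ← mul_assoc, h.p_idem]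
      · fin_cases a <;> simp [spanningFamily, ← mul_assoc, h.p_mul, hij]
    rw [h3]
    split_ifs
    · exact Submodule.subset_span ⟨_, rfl⟩
    · exact zero_mem _
  | zero => simp
  | add x y _ _ hx hy => rw [mul_add]; exact add_mem hx hy
  | smul a x _ hx => rw [mul_smul_comm]; exact Submodule.smul_mem _ _ hx

theorem ef_mul_mem (h : PeirceRel c u p e f) (hs : RepScalars c u w) (h2 : (2 : F) ≠ 0)
    {y : R} (hy : y = e ∨ y = f) {x : R}
    (hx : x ∈ Submodule.span F (Set.range (spanningFamily w p e f))) :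
    y * x ∈ Submodule.span F (Set.range (spanningFamily w p e f)) := by
  induction hx using Submodule.span_induction with
  | mem x hx =>
    obtain ⟨⟨j, a⟩, rfl⟩ := hx
    have h3 : y * spanningFamily w p e f (j, a)
        = ∑ l, p l * y * spanningFamily w p e f (j, a) := by
      rw [← Finset.sum_mul, ← Finset.sum_mul, h.p_sum, one_mul]
    rw [h3]
    refine sum_mem fun l _ => ?_
    fin_cases a
    · rcases hy with rfl | rfl
      · exact e_mem l j
      · exact h.f_mem l j
    · change p l * y * (p j * e * p j) ∈ _
      simpa only [← mul_assoc] using h.two_step_mem hs h2 hy (Or.inl rfl) l j j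
    · change p l * y * (p j * f * p j) ∈ _
      simpa only [← mul_assoc] using h.two_step_mem hs h2 hy (Or.inr rfl) l j j
    · exact h.mul_loop_mem hs h2 hy l j
    · change p l * y * (p j * e * p (j + 1)) ∈ _
      simpa only [← mul_assoc] using h.two_step_mem hs h2 hy (Or.inl rfl) l j (j + 1)
    · change p l * y * (p j * e * p (j + 2)) ∈ _
      simpa only [← mul_assoc] using h.two_step_mem hs h2 hy (Or.inl rfl) l j (j + 2)
  | zero => simp
  | add x y _ _ hx hy => rw [mul_add]; exact add_mem hx hy
  | smul a x _ hx => rw [mul_smul_comm]; exact Submodule.smul_mem _ _ hx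

theorem span_eq_top (h : PeirceRel c u p e f) (hs : RepScalars c u w) (h2 : (2 : F) ≠ 0)
    (hgen : Algebra.adjoin F (Set.range p ∪ {e, f}) = ⊤) :
    Submodule.span F (Set.range (spanningFamily w p e f)) = ⊤ := by
  set T := Submodule.span F (Set.range (spanningFamily w p e f)) with hT
  have h1 : (1 : R) ∈ T := by
    rw [← h.p_sum]
    exact sum_mem fun i _ => Submodule.subset_span ⟨(i, 0), rfl⟩
  have key (x : R) : ∀ y ∈ T, x * y ∈ T := by
    have hx : x ∈ Algebra.adjoin F (Set.range p ∪ {e, f}) := by rw [hgen]; trivial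
    induction hx using Algebra.adjoin_induction with
    | mem x hx =>
      intro y hy
      rcases hx with ⟨i, rfl⟩ | hx
      · exact h.p_mul_mem i hy
      · exact h.ef_mul_mem hs h2 hx hy
    | algebraMap r => intro y hy; rw [← Algebra.smul_def]; exact T.smul_mem _ hy
    | add a b _ _ ha hb => intro y hy; rw [add_mul]; exact add_mem (ha y hy) (hb y hy)
    | mul a b _ _ ha hb => intro y hy; rw [mul_assoc]; exact ha _ (hb y hy)
  exact (Submodule.eq_top_iff').2 fun x => by simpa using key x 1 h1

theorem finite_and_finrank_le (h : PeirceRel c u p e f) (hs : RepScalars c u w)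
    (h2 : (2 : F) ≠ 0) (hgen : Algebra.adjoin F (Set.range p ∪ {e, f}) = ⊤) :
    Module.Finite F R ∧ Module.finrank F R ≤ 18 := by
  have hT := h.span_eq_top hs h2 hgen
  refine ⟨⟨(Submodule.fg_def).2 ⟨_, Set.finite_range _, hT⟩⟩, ?_⟩
  have := finrank_range_le_card (R := F) (spanningFamily w p e f)
  rw [Set.finrank, hT, finrank_top] at this
  simpa using this

end PeirceRel

section FreeProduct

variable {k A B R : Type} [Field k] [Ring A] [Ring B] [Semiring R] [Algebra k A] [Algebra k B]
  [Algebra k R]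

/-- The algebra homomorphism out of a binary free product determined by its two components. -/
noncomputable def FP.desc (f : A →ₐ[k] R) (g : B →ₐ[k] R) : FP k A B →ₐ[k] R :=
  LinearAlgebra.FreeProduct.lift k (fam A B) fun {b} =>
    match b with
    | true => f
    | false => g

theorem FP.desc_inl (f : A →ₐ[k] R) (g : B →ₐ[k] R) (a : A) :
    FP.desc f g (inl k A B a) = f a :=
  DFunLike.congr_fun (LinearAlgebra.FreeProduct.lift_comp_ι (i := true) k (fam A B)
    (fun {b} => match b with
    | true => f
    | false => g)) a

theorem FP.desc_inr (f : A →ₐ[k] R) (g : B →ₐ[k] R) (b : B) :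
    FP.desc f g (inr k A B b) = g b :=
  DFunLike.congr_fun (LinearAlgebra.FreeProduct.lift_comp_ι (i := false) k (fam A B)
    (fun {b} => match b with
    | true => f
    | false => g)) b

theorem FP.hom_ext {φ ψ : FP k A B →ₐ[k] R}
    (hl : ∀ a, φ (inl k A B a) = ψ (inl k A B a))
    (hr : ∀ b, φ (inr k A B b) = ψ (inr k A B b)) : φ = ψ := by
  refine (LinearAlgebra.FreeProduct.lift k (fam A B) (B := R)).symm.injective ?_
  funext b
  cases b
  · exact AlgHom.ext hr
  · exact AlgHom.ext hl

theorem FP.eq_top_of_mem (S : Subalgebra k (FP k A B)) (hl : ∀ a, inl k A B a ∈ S)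
    (hr : ∀ b, inr k A B b ∈ S) : S = ⊤ := by
  have h : S.val.comp (FP.desc ((inl k A B).codRestrict S hl) ((inr k A B).codRestrict S hr))
      = AlgHom.id k _ :=
    FP.hom_ext (fun a => by simp [FP.desc_inl]) (fun b => by simp [FP.desc_inr])
  refine (eq_top_iff).2 fun x _ => ?_
  rw [← AlgHom.id_apply (R := k) x, ← h]
  exact Subtype.property _

/-- The homomorphism `kⁿ → R` determined by a complete family of orthogonal idempotents. -/
noncomputable def AlgHom.ofIdempotents {n : Type} [Fintype n] [DecidableEq n] (e : n → R)
    (he : CompleteOrthogonalIdempotents e) : (n → k) →ₐ[k] R :=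
  AlgHom.ofLinearMap (Fintype.linearCombination k e)
    (by simp [Fintype.linearCombination_apply, he.complete])
    (fun x y => by
      simp only [Fintype.linearCombination_apply, Finset.sum_mul_sum, Pi.mul_apply, smul_mul_smul,
        he.toOrthogonalIdempotents.mul_eq]
      simp)

theorem AlgHom.ofIdempotents_single {n : Type} [Fintype n] [DecidableEq n] (e : n → R)
    (he : CompleteOrthogonalIdempotents e) (i : n) :
    AlgHom.ofIdempotents (k := k) e he (Pi.single i 1) = e i := by
  simp [AlgHom.ofIdempotents]

theorem completeOrthogonalIdempotents_single (n : Type) [Fintype n] [DecidableEq n] :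
    CompleteOrthogonalIdempotents (fun i : n => (Pi.single i 1 : n → k)) :=
  CompleteOrthogonalIdempotents.single (fun _ => k)

end FreeProduct

section Generators

variable (k : Type) [Field k]

theorem pgen_complete : CompleteOrthogonalIdempotents (pgen k) :=
  (completeOrthogonalIdempotents_single (Fin 3)).map
    (inl (Ffield k) (Fin 3 → Ffield k) (Fin 3 → Ffield k)).toRingHom

theorem qgen_complete : CompleteOrthogonalIdempotents (qgen k) :=
  (completeOrthogonalIdempotents_single (Fin 3)).map
    (inr (Ffield k) (Fin 3 → Ffield k) (Fin 3 → Ffield k)).toRingHom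

theorem eq_top_of_gens_mem
    (S : Subalgebra (Ffield k) (FP (Ffield k) (Fin 3 → Ffield k) (Fin 3 → Ffield k)))
    (hp : ∀ i, pgen k i ∈ S) (hq : ∀ i, qgen k i ∈ S) : S = ⊤ := by
  refine FP.eq_top_of_mem S (fun a => ?_) (fun a => ?_)
  · rw [pi_eq_sum_univ' a, map_sum]
    refine sum_mem fun i _ => ?_
    rw [map_smul]
    convert S.smul_mem (hp i) (a i) using 2
    rw [pgen]
  · rw [pi_eq_sum_univ' a, map_sum]
    refine sum_mem fun i _ => ?_
    rw [map_smul]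
    convert S.smul_mem (hq i) (a i) using 2
    rw [qgen]

/-- The quotient map `𝒜 * ℬ → 𝒮`. -/
noncomputable def Salg.mk :
    FP (Ffield k) (Fin 3 → Ffield k) (Fin 3 → Ffield k) →ₐ[Ffield k] Salg k :=
  RingQuot.mkAlgHom _ _

theorem Salg.mk_surjective : Function.Surjective (Salg.mk k) :=
  RingQuot.mkAlgHom_surjective _ _

theorem Salg.mk_Xrel : Salg.mk k (Xrel k) = 0 := by
  have := RingQuot.mkAlgHom_rel (Ffield k)
    (s := fun u v => u = Xrel k ∧ v = 0) (x := Xrel k) (y := 0) ⟨rfl, rfl⟩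
  rw [map_zero] at this
  exact this

theorem Salg.exists_desc {R : Type} [Ring R] [Algebra (Ffield k) R]
    (φ : FP (Ffield k) (Fin 3 → Ffield k) (Fin 3 → Ffield k) →ₐ[Ffield k] R)
    (hφ : φ (Xrel k) = 0) :
    ∃ ψ : Salg k →ₐ[Ffield k] R, ∀ x, ψ (Salg.mk k x) = φ x :=
  ⟨RingQuot.liftAlgHom _ ⟨φ, by rintro _ _ ⟨rfl, rfl⟩; rw [hφ, map_zero]⟩,
    fun x => RingQuot.liftAlgHom_mkAlgHom_apply _ _ _ x⟩

end Generators

section Model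

variable {F : Type} [Field F]

theorem repScalars_of_generic {u : Fin 3 → F} (hu : Function.Injective u) (h0 : ∀ i, u i ≠ 0)
    (h1 : ∀ i, 1 + u i ≠ 0) :
    ∃ w, RepScalars (u 0 * u 1 * u 2)⁻¹ u w := by
  have hne {i j : Fin 3} (hij : i ≠ j) : u i - u j ≠ 0 := sub_ne_zero.2 (hu.ne hij)
  have h01 := hne (i := 0) (j := 1) (by decide)
  have h02 := hne (i := 0) (j := 2) (by decide)
  have h12 := hne (i := 1) (j := 2) (by decide)
  have h10 := hne (i := 1) (j := 0) (by decide)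
  have h20 := hne (i := 2) (j := 0) (by decide)
  have h21 := hne (i := 2) (j := 1) (by decide)
  have a0 := h0 0
  have a1 := h0 1
  have a2 := h0 2
  have b0 := h1 0
  have b1 := h1 1
  have b2 := h1 2
  refine ⟨![u 1 * u 2 * (1 + u 0) / ((u 0 - u 1) * (u 0 - u 2)),
    u 0 * u 2 * (1 + u 1) / ((u 1 - u 0) * (u 1 - u 2)),
    u 0 * u 1 * (1 + u 2) / ((u 2 - u 0) * (u 2 - u 1))], hu, ?_, ?_, ?_, ?_, ?_, ?_⟩
  · field_simp
  · intro i
    fin_cases i <;> simp [h01, h02, h12, h10, h20, h21, a0, a1, a2, b0, b1, b2]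
  · intro i j k hij hik hjk
    fin_cases i <;> fin_cases j <;> first | exact absurd rfl hij | skip
    all_goals fin_cases k <;>
      first | exact absurd rfl hik | exact absurd rfl hjk | (simp; field_simp; try ring)
  all_goals
    simp [Fin.sum_univ_three]
    rw [← neg_sub (u 0) (u 1), ← neg_sub (u 0) (u 2), ← neg_sub (u 1) (u 2)]
    field_simp
    ring

/-- The rank one idempotents with entries `w j` and `c * u i * u j * w j`, and their complement. -/
def modelQ (c : F) (u w : Fin 3 → F) : Fin 3 → Matrix (Fin 3) (Fin 3) F :=
  let e : Matrix (Fin 3) (Fin 3) F := Matrix.of fun _ j => w j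
  let f : Matrix (Fin 3) (Fin 3) F := Matrix.of fun i j => c * (u i * u j) * w j
  ![e, f, 1 - e - f]

theorem modelQ_complete {c : F} {u w : Fin 3 → F} (hs : RepScalars c u w) :
    CompleteOrthogonalIdempotents (modelQ c u w) := by
  have e1 := hs.sum_w
  have e2 := hs.sum_uw
  have e3 := hs.sum_uuw
  set e : Matrix (Fin 3) (Fin 3) F := Matrix.of fun _ j => w j with he
  set f : Matrix (Fin 3) (Fin 3) F := Matrix.of fun i j => c * (u i * u j) * w j with hf
  have hee : e * e = e := by
    ext i j
    simp only [he, Matrix.mul_apply, Matrix.of_apply, ← Finset.sum_mul, e1, one_mul]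
  have hff : f * f = f := by
    ext i j
    simp only [hf, Matrix.mul_apply, Matrix.of_apply]
    have : ∀ l, c * (u i * u l) * w l * (c * (u l * u j) * w j)
      = c * (u l * u l * w l) * (c * (u i * u j) * w j) := fun l => by ring
    simp only [this, ← Finset.sum_mul, ← Finset.mul_sum, e3, one_mul]
  have hef : e * f = 0 := by
    ext i j
    simp only [he, hf, Matrix.mul_apply, Matrix.of_apply]
    have : ∀ l, w l * (c * (u l * u j) * w j)
      = (u l * w l) * (c * u j * w j) := fun l => by ring
    simp only [this, ← Finset.sum_mul, e2, zero_mul, Matrix.zero_apply]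
  have hfe : f * e = 0 := by
    ext i j
    simp only [he, hf, Matrix.mul_apply, Matrix.of_apply]
    have : ∀ l, c * (u i * u l) * w l * w j
      = (u l * w l) * (c * u i * w j) := fun l => by ring
    simp only [this, ← Finset.sum_mul, e2, zero_mul, Matrix.zero_apply]
  have hQ : modelQ c u w = ![e, f, 1 - e - f] := rfl
  rw [hQ]
  refine ⟨⟨fun i => ?_, fun i j hij => ?_⟩, ?_⟩
  · rw [IsIdempotentElem]
    fin_cases i <;> simp [mul_sub, sub_mul, hee, hff, hef, hfe]
  · fin_cases i <;> fin_cases j <;> first | exact absurd rfl hij | skip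
    all_goals simp [mul_sub, sub_mul, hee, hff, hef, hfe]
  · simp [Fin.sum_univ_three]

/-- The diagonal matrix units. -/
def modelP (F : Type) [Field F] (i : Fin 3) : Matrix (Fin 3) (Fin 3) F := Matrix.single i i 1

theorem modelP_complete : CompleteOrthogonalIdempotents (modelP F) := by
  refine ⟨⟨fun i => ?_, fun i j hij => ?_⟩, ?_⟩
  · simp [IsIdempotentElem, modelP]
  · simp [modelP, hij]
  · ext i j
    rw [Fin.sum_univ_three]
    fin_cases i <;> fin_cases j <;> simp [modelP]

theorem modelP_mul_mul (M : Matrix (Fin 3) (Fin 3) F) (i j : Fin 3) :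
    modelP F i * M * modelP F j = M i j • Matrix.single i j 1 := by
  simp [modelP]

theorem surjective_of_model {A : Type} [Ring A] [Algebra F A] {c : F} {u w : Fin 3 → F}
    (hs : RepScalars c u w) (φ : A →ₐ[F] (Fin 3 × Fin 3 → F) × Matrix (Fin 3) (Fin 3) F)
    {p q : Fin 3 → A}
    (hp : ∀ i, φ (p i) = (fun x => if x.1 = i then 1 else 0, modelP F i))
    (hq : ∀ i, φ (q i) = (fun x => if x.2 = i then 1 else 0, modelQ c u w i)) :
    Function.Surjective φ := by
  have off {i j : Fin 3} (hij : i ≠ j) : ((0, Matrix.single i j 1) :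
      (Fin 3 × Fin 3 → F) × Matrix (Fin 3) (Fin 3) F) ∈ φ.range := by
    refine ⟨(w j)⁻¹ • (p i * q 0 * p j), ?_⟩
    have h0 : modelQ c u w 0 i j = w j := rfl
    have h1 : (fun x : Fin 3 × Fin 3 => if x.1 = i then (1 : F) else 0)
        * (fun x => if x.2 = 0 then 1 else 0) * (fun x => if x.1 = j then 1 else 0) = 0 := by
      ext x
      by_cases hx : x.1 = i
      · simp [hx, hij]
      · simp [hx]
    simp [hp, hq, modelP_mul_mul, h0, h1, hs.w_ne j]
  have unit (i j : Fin 3) : ((0, Matrix.single i j 1) :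
      (Fin 3 × Fin 3 → F) × Matrix (Fin 3) (Fin 3) F) ∈ φ.range := by
    by_cases hij : i = j
    · subst hij
      obtain ⟨m, hm⟩ := (by decide : ∀ i : Fin 3, ∃ m, i ≠ m) i
      simpa using mul_mem (off hm) (off hm.symm)
    · exact off hij
  have right (M : Matrix (Fin 3) (Fin 3) F) :
      ((0, M) : (Fin 3 × Fin 3 → F) × Matrix (Fin 3) (Fin 3) F) ∈ φ.range := by
    have h : ((0, M) : (Fin 3 × Fin 3 → F) × Matrix (Fin 3) (Fin 3) F)
        = ∑ i, ∑ j, M i j • (0, Matrix.single i j 1) := by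
      refine Prod.ext (by simp [Prod.fst_sum]) ?_
      conv_lhs => rw [Matrix.matrix_eq_sum_single M]
      simp [Prod.snd_sum, Matrix.smul_single]
    rw [h]
    exact sum_mem fun i _ => sum_mem fun j _ => φ.range.smul_mem (unit i j) _
  have left (x : Fin 3 × Fin 3) : ((Pi.single x 1, 0) :
      (Fin 3 × Fin 3 → F) × Matrix (Fin 3) (Fin 3) F) ∈ φ.range := by
    have h : ((Pi.single x 1, 0) : (Fin 3 × Fin 3 → F) × Matrix (Fin 3) (Fin 3) F)
        = φ (p x.1 * q x.2) - (0, modelP F x.1 * modelQ c u w x.2) := by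
      refine Prod.ext ?_ (by simp [hp, hq])
      ext y
      by_cases h1 : y.1 = x.1 <;> by_cases h2 : y.2 = x.2 <;>
        simp [hp, hq, Pi.single_apply, Prod.ext_iff, h1, h2]
    rw [h]
    exact sub_mem ⟨_, rfl⟩ (right _)
  rintro ⟨g, M⟩
  have h : ((g, M) : (Fin 3 × Fin 3 → F) × Matrix (Fin 3) (Fin 3) F)
      = ∑ x, g x • (Pi.single x 1, 0) + (0, M) := by
    refine Prod.ext ?_ (by simp [Prod.snd_sum])
    ext y
    simp [Prod.fst_sum, Finset.sum_apply, Pi.single_apply]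
  rw [h]
  exact add_mem (sum_mem fun x _ => φ.range.smul_mem (left x) _) (right M)

end Model

/-- The off-diagonal relations follow from multiplying the relation `X = 0` by `pᵢ` and `pⱼ`. -/
theorem off_of_relation {F R : Type*} [Field F] [Ring R] [Algebra F R] {p : Fin 3 → R}
    {e f : R} {c : F} {u y : Fin 3 → F} (hp : ∀ i j, p i * p j = if i = j then p i else 0)
    (hX : (p 0 * e - e * p 0) + y 0 • (p 0 * f - f * p 0)
      + y 1 • (p 1 * e - e * p 1) + y 2 • (p 1 * f - f * p 1) = 0)
    (h0 : y 0 ≠ 0) (h2 : y 2 ≠ 0) (h02 : y 0 - y 2 ≠ 0)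
    (u01 : (y 0 - y 2) * (c * (u 0 * u 1)) = y 1 - 1) (u02 : y 0 * (c * (u 0 * u 2)) = -1)
    (u12 : y 2 * (c * (u 1 * u 2)) = -y 1) {i j : Fin 3} (hij : i ≠ j) :
    p i * f * p j = (c * (u i * u j)) • (p i * e * p j) := by
  have hpr (i j) (x : R) : x * p i * p j = if i = j then x * p i else 0 := by
    rw [mul_assoc, hp]; split_ifs <;> simp
  have key (i j : Fin 3) := congrArg (fun x => p i * x * p j) hX
  simp only [mul_add, add_mul, mul_sub, sub_mul, mul_smul_comm, smul_mul_assoc, ← mul_assoc, hp,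
    hpr, mul_zero, zero_mul] at key
  fin_cases i <;> fin_cases j <;> first | exact absurd rfl hij | skip
  all_goals simp only [Fin.zero_eta, Fin.mk_one, Fin.reduceFinMk]
  · have := key 0 1
    simp at this
    refine smul_right_injective _ h02 ?_
    dsimp only
    rw [smul_smul, u01]
    linear_combination (norm := module) this
  · have := key 0 2
    simp at this
    refine smul_right_injective _ h0 ?_
    dsimp only
    rw [smul_smul, u02]
    linear_combination (norm := module) this
  · have := key 1 0
    simp at this
    refine smul_right_injective _ h02 ?_
    dsimp only
    rw [smul_smul, mul_comm (u 1), u01]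
    linear_combination (norm := module) -this
  · have := key 1 2
    simp at this
    refine smul_right_injective _ h2 ?_
    dsimp only
    rw [smul_smul, u12]
    linear_combination (norm := module) this
  · have := key 2 0
    simp at this
    refine smul_right_injective _ h0 ?_
    dsimp only
    rw [smul_smul, mul_comm (u 2), u02]
    linear_combination (norm := module) -this
  · have := key 2 1
    simp at this
    refine smul_right_injective _ h2 ?_
    dsimp only
    rw [smul_smul, mul_comm (u 2), u12]
    linear_combination (norm := module) -this

section RationalFunctions

variable (k : Type) [Field k]

theorem algebraMap_ne_zero_of_eval (P : MvPolynomial (Fin 3) k) (a : Fin 3 → k)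
    (h : MvPolynomial.eval a P ≠ 0) :
    algebraMap (MvPolynomial (Fin 3) k) (Ffield k) P ≠ 0 := by
  intro h0
  have : P = 0 := IsFractionRing.injective (MvPolynomial (Fin 3) k) (Ffield k) (by simpa using h0)
  simp [this] at h

/-- The scalars `1 / cᵢⱼ`, where `pᵢ q₂ pⱼ = cᵢⱼ pᵢ q₁ pⱼ` in `𝒮`, indexed by the third index. -/
noncomputable def uvar : Fin 3 → Ffield k :=
  ![-yvar k 2 / yvar k 1, -yvar k 0, (yvar k 0 - yvar k 2) / (yvar k 1 - 1)]

theorem yvar_generic [CharZero k] :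
    yvar k 0 ≠ 0 ∧ yvar k 1 ≠ 0 ∧ yvar k 2 ≠ 0 ∧ yvar k 0 - yvar k 2 ≠ 0 ∧ yvar k 1 - 1 ≠ 0 ∧
    yvar k 1 - yvar k 2 ≠ 0 ∧ 1 - yvar k 0 ≠ 0 ∧ yvar k 1 - 1 + yvar k 0 - yvar k 2 ≠ 0 ∧
    yvar k 0 * yvar k 1 - yvar k 2 ≠ 0 := by
  have key (P : MvPolynomial (Fin 3) k) (h : MvPolynomial.eval ![2, 3, 5] P ≠ 0) :=
    algebraMap_ne_zero_of_eval k P _ h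
  refine ⟨?_, ?_, ?_, ?_, ?_, ?_, ?_, ?_, ?_⟩
  · simpa only [yvar] using key (.X 0) (by simp)
  · simpa only [yvar] using key (.X 1) (by simp)
  · simpa only [yvar] using key (.X 2) (by simp)
  · simpa only [yvar, map_sub] using key (.X 0 - .X 2) (by simp; norm_num)
  · simpa only [yvar, map_sub, map_one] using key (.X 1 - 1) (by simp; norm_num)
  · simpa only [yvar, map_sub] using key (.X 1 - .X 2) (by simp; norm_num)
  · simpa only [yvar, map_sub, map_one] using key (1 - .X 0) (by simp; norm_num)
  · simpa only [yvar, map_sub, map_add, map_one] using key (.X 1 - 1 + .X 0 - .X 2)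
      (by simp; norm_num)
  · simpa only [yvar, map_sub, map_mul] using key (.X 0 * .X 1 - .X 2) (by simp; norm_num)

theorem exists_repScalars [CharZero k] :
    ∃ w, RepScalars (uvar k 0 * uvar k 1 * uvar k 2)⁻¹ (uvar k) w := by
  obtain ⟨h0, h1, h2, h02, h11, h12, h00, hs, hp⟩ := yvar_generic k
  refine repScalars_of_generic ?_ ?_ ?_
  · have a01 : uvar k 0 ≠ uvar k 1 := by
      simp only [uvar, Matrix.cons_val]
      rw [Ne, div_eq_iff h1]
      intro h
      exact hp (by linear_combination h)
    have a02 : uvar k 0 ≠ uvar k 2 := by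
      simp only [uvar, Matrix.cons_val]
      rw [Ne, div_eq_div_iff h1 h11]
      intro h
      exact hp (by linear_combination -h)
    have a12 : uvar k 1 ≠ uvar k 2 := by
      simp only [uvar, Matrix.cons_val]
      rw [Ne, eq_div_iff h11]
      intro h
      exact hp (by linear_combination -h)
    intro i j h
    fin_cases i <;> fin_cases j <;>
      first
      | rfl
      | exact absurd h a01
      | exact absurd h a02
      | exact absurd h a12
      | exact absurd h.symm a01
      | exact absurd h.symm a02
      | exact absurd h.symm a12
  · intro i
    fin_cases i <;> simp [uvar, h0, h1, h2, h02, h11]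
  · intro i
    fin_cases i
    · simp only [uvar, Fin.zero_eta, Matrix.cons_val]
      intro h
      field_simp at h
      exact h12 (by linear_combination h)
    · simp only [uvar, Fin.mk_one, Matrix.cons_val]
      intro h
      exact h00 (by linear_combination h)
    · simp only [uvar, Fin.reduceFinMk, Matrix.cons_val]
      intro h
      field_simp at h
      exact hs (by linear_combination h)

/-- The off-diagonal coefficients in terms of the variables. -/
theorem uvar_mul [CharZero k] :
    (yvar k 0 - yvar k 2) * ((uvar k 0 * uvar k 1 * uvar k 2)⁻¹ * (uvar k 0 * uvar k 1))
      = yvar k 1 - 1 ∧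
    yvar k 0 * ((uvar k 0 * uvar k 1 * uvar k 2)⁻¹ * (uvar k 0 * uvar k 2)) = -1 ∧
    yvar k 2 * ((uvar k 0 * uvar k 1 * uvar k 2)⁻¹ * (uvar k 1 * uvar k 2)) = -yvar k 1 := by
  obtain ⟨h0, h1, h2, h02, h11, -⟩ := yvar_generic k
  simp only [uvar, Matrix.cons_val]
  refine ⟨?_, ?_, ?_⟩ <;> field_simp

/-- `y₁` is not a cube in `k(y₁,y₂,y₃)`. -/
theorem pow_three_ne_yvar (b : Ffield k) : b ^ 3 ≠ yvar k 0 := by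
  intro hb
  have hint : IsIntegral (MvPolynomial (Fin 3) k) b := by
    refine IsIntegral.of_pow (n := 3) (by norm_num) ?_
    rw [hb]
    exact isIntegral_algebraMap
  obtain ⟨P, rfl⟩ := (IsIntegrallyClosed.isIntegral_iff).1 hint
  rw [yvar, ← map_pow] at hb
  have hP : P ^ 3 = MvPolynomial.X 0 := IsFractionRing.injective _ (Ffield k) hb
  have hirr : Irreducible (P ^ 3) := by
    rw [hP]
    exact MvPolynomial.X_prime.irreducible
  exact not_irreducible_pow (by norm_num) hirr

theorem exists_cubic_extension :
    ∃ (K : Type) (_ : Field K) (_ : Algebra (Ffield k) K), Module.finrank (Ffield k) K = 3 := by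
  have hirr : Irreducible (Polynomial.X ^ 3 - Polynomial.C (yvar k 0)) :=
    X_pow_sub_C_irreducible_of_prime Nat.prime_three (pow_three_ne_yvar k)
  have := Fact.mk hirr
  refine ⟨AdjoinRoot (Polynomial.X ^ 3 - Polynomial.C (yvar k 0)), inferInstance, inferInstance, ?_⟩
  rw [(AdjoinRoot.powerBasis hirr.ne_zero).finrank, AdjoinRoot.powerBasis_dim,
    Polynomial.natDegree_X_pow_sub_C]

end RationalFunctions

section Structure

variable (k : Type) [Field k]

theorem FP.map_Xrel {R : Type} [Ring R] [Algebra (Ffield k) R]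
    (φ : FP (Ffield k) (Fin 3 → Ffield k) (Fin 3 → Ffield k) →ₐ[Ffield k] R) :
    φ (Xrel k) = (φ (pgen k 0) * φ (qgen k 0) - φ (qgen k 0) * φ (pgen k 0))
      + yvar k 0 • (φ (pgen k 0) * φ (qgen k 1) - φ (qgen k 1) * φ (pgen k 0))
      + yvar k 1 • (φ (pgen k 1) * φ (qgen k 0) - φ (qgen k 0) * φ (pgen k 1))
      + yvar k 2 • (φ (pgen k 1) * φ (qgen k 1) - φ (qgen k 1) * φ (pgen k 1)) := by
  have sub (x y) : φ (x - y) = φ x - φ y :=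
    eq_sub_of_add_eq ((map_add φ _ _).symm.trans (congrArg φ (sub_add_cancel x y)))
  have comm (a b : FP (Ffield k) (Fin 3 → Ffield k) (Fin 3 → Ffield k)) :
      φ (a * b - b * a) = φ a * φ b - φ b * φ a :=
    (sub _ _).trans (congrArg₂ _ (map_mul φ a b) (map_mul φ b a))
  rw [← comm, ← comm, ← comm, ← comm, ← map_smul, ← map_smul, ← map_smul, ← map_add, ← map_add,
    ← map_add]
  rfl

theorem Salg.peirceRel [CharZero k] :
    PeirceRel (uvar k 0 * uvar k 1 * uvar k 2)⁻¹ (uvar k) (fun i => Salg.mk k (pgen k i))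
      (Salg.mk k (qgen k 0)) (Salg.mk k (qgen k 1)) := by
  have hp := (pgen_complete k).map (Salg.mk k).toRingHom
  have hq := (qgen_complete k).map (Salg.mk k).toRingHom
  have hpm (i j) : Salg.mk k (pgen k i) * Salg.mk k (pgen k j)
      = if i = j then Salg.mk k (pgen k i) else 0 := hp.toOrthogonalIdempotents.mul_eq i j
  have hqm (i j) : Salg.mk k (qgen k i) * Salg.mk k (qgen k j)
      = if i = j then Salg.mk k (qgen k i) else 0 := hq.toOrthogonalIdempotents.mul_eq i j
  obtain ⟨h0, -, h2, h02, -⟩ := yvar_generic k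
  obtain ⟨u01, u02, u12⟩ := uvar_mul k
  refine ⟨hpm, hp.complete, ?_, ?_, ?_, ?_, fun i j hij => off_of_relation (y := yvar k) hpm
    ((FP.map_Xrel k (Salg.mk k)).symm.trans (Salg.mk_Xrel k)) h0 h2 h02 u01 u02 u12 hij⟩
  · simpa using hqm 0 0
  · simpa using hqm 1 1
  · simpa using hqm 0 1
  · simpa using hqm 1 0

theorem Salg.adjoin_eq_top :
    Algebra.adjoin (Ffield k) (Set.range (fun i => Salg.mk k (pgen k i))
      ∪ {Salg.mk k (qgen k 0), Salg.mk k (qgen k 1)}) = ⊤ := by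
  set S := Algebra.adjoin (Ffield k) (Set.range (fun i => Salg.mk k (pgen k i))
      ∪ {Salg.mk k (qgen k 0), Salg.mk k (qgen k 1)})
  have hp (i) : Salg.mk k (pgen k i) ∈ S := Algebra.subset_adjoin (Or.inl ⟨i, rfl⟩)
  have h0 : Salg.mk k (qgen k 0) ∈ S := Algebra.subset_adjoin (Or.inr (by simp))
  have h1 : Salg.mk k (qgen k 1) ∈ S := Algebra.subset_adjoin (Or.inr (by simp))
  have h2 : Salg.mk k (qgen k 2) ∈ S := by
    have h : ∑ i, Salg.mk k (qgen k i) = 1 :=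
      ((qgen_complete k).map (Salg.mk k).toRingHom).complete
    rw [Fin.sum_univ_three] at h
    rw [eq_sub_of_add_eq' h]
    exact sub_mem (one_mem S) (add_mem h0 h1)
  have hS := eq_top_of_gens_mem k (S.comap (Salg.mk k)) hp
    (by intro i; fin_cases i <;> [exact h0; exact h1; exact h2])
  refine (eq_top_iff).2 fun x _ => ?_
  obtain ⟨y, rfl⟩ := Salg.mk_surjective k x
  have : y ∈ S.comap (Salg.mk k) := by rw [hS]; trivial
  exact this

theorem Salg.exists_model [CharZero k] {w : Fin 3 → Ffield k}
    (hs : RepScalars (uvar k 0 * uvar k 1 * uvar k 2)⁻¹ (uvar k) w) :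
    ∃ φ : Salg k →ₐ[Ffield k]
        (Fin 3 × Fin 3 → Ffield k) × Matrix (Fin 3) (Fin 3) (Ffield k),
      Function.Surjective φ := by
  obtain ⟨u01, u02, u12⟩ := uvar_mul k
  let φ₁ : FP (Ffield k) (Fin 3 → Ffield k) (Fin 3 → Ffield k) →ₐ[Ffield k]
      (Fin 3 × Fin 3 → Ffield k) :=
    FP.desc (AlgHom.pi fun x => Pi.evalAlgHom _ _ x.1)
      (AlgHom.pi fun x => Pi.evalAlgHom _ _ x.2)
  let φ₂ : FP (Ffield k) (Fin 3 → Ffield k) (Fin 3 → Ffield k) →ₐ[Ffield k]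
      Matrix (Fin 3) (Fin 3) (Ffield k) :=
    FP.desc (AlgHom.ofIdempotents _ modelP_complete) (AlgHom.ofIdempotents _ (modelQ_complete hs))
  have hp₁ (i) : φ₁ (pgen k i) = fun x => if x.1 = i then 1 else 0 := by
    ext x
    simp [φ₁, pgen, FP.desc_inl, Pi.single_apply]
  have hq₁ (i) : φ₁ (qgen k i) = fun x => if x.2 = i then 1 else 0 := by
    ext x
    simp [φ₁, qgen, FP.desc_inr, Pi.single_apply]
  have hp₂ (i) : φ₂ (pgen k i) = modelP (Ffield k) i := by
    simp only [φ₂, pgen, FP.desc_inl, AlgHom.ofIdempotents_single]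
  have hq₂ (i) : φ₂ (qgen k i) = modelQ (uvar k 0 * uvar k 1 * uvar k 2)⁻¹ (uvar k) w i := by
    simp only [φ₂, qgen, FP.desc_inr, AlgHom.ofIdempotents_single]
  have hX₁ : φ₁ (Xrel k) = 0 := by
    rw [FP.map_Xrel]
    simp [mul_comm]
  have hX₂ : φ₂ (Xrel k) = 0 := by
    rw [FP.map_Xrel]
    simp only [hp₂, hq₂]
    ext i j
    fin_cases i <;> fin_cases j <;>
      simp [modelP, modelQ, Matrix.mul_apply, Matrix.single_apply, -mul_inv_rev]
    · linear_combination w 1 * u01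
    · linear_combination w 2 * u02
    · linear_combination -w 0 * u01
    · linear_combination w 2 * u12
    · linear_combination -w 0 * u02
    · linear_combination -w 1 * u12
  obtain ⟨ψ, hψ⟩ := Salg.exists_desc k (φ₁.prod φ₂)
    (by rw [AlgHom.prod_apply, hX₁, hX₂]; rfl)
  refine ⟨ψ, surjective_of_model hs ψ (p := fun i => Salg.mk k (pgen k i))
    (q := fun i => Salg.mk k (qgen k i)) (fun i => ?_) (fun i => ?_)⟩
  · rw [hψ, AlgHom.prod_apply, hp₁, hp₂]
  · rw [hψ, AlgHom.prod_apply, hq₁, hq₂]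

/-- The algebra `𝒮` is already split over `F`. -/
theorem Salg.nonempty_algEquiv [CharZero k] :
    Nonempty (Salg k ≃ₐ[Ffield k]
      (Fin 9 → Ffield k) × Matrix (Fin 3) (Fin 3) (Ffield k)) := by
  obtain ⟨w, hs⟩ := exists_repScalars k
  obtain ⟨φ, hφ⟩ := Salg.exists_model k hs
  have : CharZero (Ffield k) :=
    charZero_of_injective_algebraMap (FaithfulSMul.algebraMap_injective k (Ffield k))
  obtain ⟨hfin, hle⟩ := (Salg.peirceRel k).finite_and_finrank_le hs two_ne_zero
    (Salg.adjoin_eq_top k)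
  have hrank : Module.finrank (Ffield k)
      ((Fin 3 × Fin 3 → Ffield k) × Matrix (Fin 3) (Fin 3) (Ffield k)) = 18 := by
    simp [Module.finrank_matrix]
  have hge := LinearMap.finrank_le_finrank_of_surjective (f := φ.toLinearMap) hφ
  have heq : Module.finrank (Ffield k) (Salg k) = Module.finrank (Ffield k)
      ((Fin 3 × Fin 3 → Ffield k) × Matrix (Fin 3) (Fin 3) (Ffield k)) := by omega
  have hinj : Function.Injective φ :=
    (LinearMap.injective_iff_surjective_of_finrank_eq_finrank (f := φ.toLinearMap) heq).2 hφ
  exact ⟨(AlgEquiv.ofBijective φ ⟨hinj, hφ⟩).trans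
    (AlgEquiv.prodCongr (AlgEquiv.piCongrLeft (Ffield k) (fun _ : Fin 9 => Ffield k)
      (finProdFinEquiv : Fin 3 × Fin 3 ≃ Fin 9)) AlgEquiv.refl)⟩

end Structure

/-- Matrix algebras are stable under base change. -/
noncomputable def baseChangeMatrixEquiv (F K n : Type) [Field F] [Field K] [Algebra F K]
    [Fintype n] [DecidableEq n] : K ⊗[F] Matrix n n F ≃ₐ[K] Matrix n n K :=
  AlgEquiv.ofRingEquiv (f := (matrixEquivTensor n F K).symm.toRingEquiv) fun a => by
    ext i j
    simp [Algebra.TensorProduct.algebraMap_apply, Matrix.one_apply, Matrix.algebraMap_matrix_apply]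

theorem statement1 (k : Type) [Field k] [IsAlgClosed k] [CharZero k] :
    ∃ (K : Type) (_ : Field K) (_ : Algebra (Ffield k) K),
      Module.finrank (Ffield k) K = 3 ∧
      Nonempty ((K ⊗[Ffield k] Salg k) ≃ₐ[K]
        ((Fin 9 → K) × Matrix (Fin 3) (Fin 3) K)) ∧
      Module.finrank (Ffield k) (Salg k) = 18 := by
  obtain ⟨K, _, _, hK⟩ := exists_cubic_extension k
  obtain ⟨φ⟩ := Salg.nonempty_algEquiv k
  refine ⟨K, inferInstance, inferInstance, hK, ⟨?_⟩, ?_⟩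
  · exact (Algebra.TensorProduct.congr AlgEquiv.refl φ).trans
      ((Algebra.TensorProduct.prodRight (Ffield k) K K _ _).trans
        (AlgEquiv.prodCongr (Algebra.TensorProduct.piScalarRight (Ffield k) K K (Fin 9))
          (baseChangeMatrixEquiv (Ffield k) K (Fin 3))))
  · rw [φ.toLinearEquiv.finrank_eq]
    simp [Module.finrank_matrix]
end

section
/- The F-algebra 𝒮 satisfies dim_F 𝒮 ≤ 18. -/
open scoped TensorProduct

set_option synthInstance.maxHeartbeats 1000000
set_option maxHeartbeats 1000000

namespace CommutatorRelation

variable {F R : Type*} [Field F] [Ring R] [Algebra F R]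

/-- The cross product of `f` with the constant vector `1`. -/
def crossOne {A : Type*} [CommRing A] (f : Fin 3 → A) (j : Fin 3) : A := f (j + 1) - f (j + 2)

/-- The cross product of the difference of two rows of `m` with the constant vector `1`. -/
def coeff {A : Type*} [CommRing A] (m : Fin 3 → Fin 3 → A) (k l : Fin 3) : Fin 3 → A :=
  crossOne (m k - m l)

/-- The genericity conditions on `m` under which the relation
`∑ i, ∑ j, m i j • [p i, q j] = 0` cuts out a finite-dimensional algebra. -/
structure Generic {A : Type*} [CommRing A] (m : Fin 3 → Fin 3 → A) : Prop where
  coeff_ne_zero : ∀ k l, k ≠ l → ∀ j, coeff m k l j ≠ 0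
  dot_ne_zero : ∀ k i l, k ≠ i → i ≠ l → k ≠ l → (m k - m l) ⬝ᵥ coeff m k i ≠ 0

section Generic

variable {A B : Type*} [CommRing A] [CommRing B] (g : A →+* B) (m : Fin 3 → Fin 3 → A)

lemma coeff_map (k l j : Fin 3) : coeff (fun i j => g (m i j)) k l j = g (coeff m k l j) := by
  simp [coeff, crossOne]

lemma dot_coeff_map (k i l : Fin 3) :
    ((fun j => g (m k j)) - fun j => g (m l j)) ⬝ᵥ coeff (fun i j => g (m i j)) k i
      = g ((m k - m l) ⬝ᵥ coeff m k i) := by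
  simp [dotProduct, coeff_map]

variable {m}

lemma Generic.of_map (h : Generic fun i j => g (m i j)) : Generic m where
  coeff_ne_zero k l hkl j h0 := h.coeff_ne_zero k l hkl j (by rw [coeff_map, h0, map_zero])
  dot_ne_zero k i l hki hil hkl h0 := h.dot_ne_zero k i l hki hil hkl
    (by rw [dot_coeff_map, h0, map_zero])

variable {g}

lemma Generic.map (hg : Function.Injective g) (h : Generic m) : Generic fun i j => g (m i j) where
  coeff_ne_zero k l hkl j := by
    rw [coeff_map]
    exact (map_ne_zero_iff g hg).2 (h.coeff_ne_zero k l hkl j)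
  dot_ne_zero k i l hki hil hkl := by
    rw [dot_coeff_map]
    exact (map_ne_zero_iff g hg).2 (h.dot_ne_zero k i l hki hil hkl)

end Generic

variable (α β : (Fin 3 → F) →ₐ[F] R) (m : Fin 3 → Fin 3 → F)

/-- The idempotent of `R` given by the `i`-th coordinate. -/
def idem (i : Fin 3) : R := α (Pi.single i 1)

lemma idem_mul_self (i : Fin 3) : idem α i * idem α i = idem α i := by
  rw [idem, ← map_mul, ← Pi.single_mul, one_mul]

lemma idem_mul_of_ne {i j : Fin 3} (h : i ≠ j) : idem α i * idem α j = 0 := by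
  rw [idem, idem, ← map_mul]
  convert map_zero α
  ext a
  by_cases ha : a = i
  · subst ha; simp [h]
  · simp [ha]

lemma sum_of_distinct {M : Type*} [AddCommMonoid M] (f : Fin 3 → M) {k i l : Fin 3}
    (hki : k ≠ i) (hil : i ≠ l) (hkl : k ≠ l) : ∑ j, f j = f k + f i + f l := by
  have h : (Finset.univ : Finset (Fin 3)) = {k, i, l} := by decide +revert
  rw [h, Finset.sum_insert (by simp [hki, hkl]), Finset.sum_pair hil, add_assoc]

lemma exists_third {k l : Fin 3} (h : k ≠ l) : ∃ i, k ≠ i ∧ i ≠ l := by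
  decide +revert

lemma sum_idem : ∑ i, idem α i = 1 := by
  simp only [idem]
  rw [← map_sum, ← map_one α]
  congr 1
  exact Finset.univ_sum_single (1 : Fin 3 → F)

lemma mul_eq_sum_idem (x y : R) {k i l : Fin 3} (hki : k ≠ i) (hil : i ≠ l) (hkl : k ≠ l) :
    x * y = x * idem α k * y + x * idem α i * y + x * idem α l * y := by
  rw [← add_mul, ← add_mul, ← mul_add, ← mul_add,
    ← sum_of_distinct (idem α) hki hil hkl, sum_idem, mul_one]

lemma coeff_add {k i l : Fin 3} : coeff m k i + coeff m i l = coeff m k l := by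
  ext j; simp [coeff, crossOne]; ring

lemma dot_coeff_self (k l : Fin 3) : (m k - m l) ⬝ᵥ coeff m k l = 0 := by
  simp [dotProduct, Fin.sum_univ_three, coeff, crossOne]; ring

lemma dot_coeff_right (k i l : Fin 3) :
    (m k - m l) ⬝ᵥ coeff m i l = -((m k - m l) ⬝ᵥ coeff m k i) := by
  have h := dot_coeff_self m k l
  rw [← coeff_add m (i := i), dotProduct_add] at h
  linear_combination h

/-- The normalised off-diagonal corner element spanning `p k * range β * p l`. -/
def unit (k l : Fin 3) : R :=
  (coeff m k l 0)⁻¹ • (idem α k * idem β 0 * idem α l)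

variable {α β m}

lemma idem_mul_unit (k l : Fin 3) : idem α k * unit α β m k l = unit α β m k l := by
  simp only [unit, mul_smul_comm, ← mul_assoc, idem_mul_self]

lemma unit_mul_idem (k l : Fin 3) : unit α β m k l * idem α l = unit α β m k l := by
  simp only [unit, smul_mul_assoc, mul_assoc, idem_mul_self]

section

variable (hm : Generic m)
  (hrel : ∑ i, (idem α i * β (m i) - β (m i) * idem α i) = 0)

include hrel in
lemma idem_mul_diff_mul_idem {k l : Fin 3} (h : k ≠ l) :
    idem α k * β (m k - m l) * idem α l = 0 := by
  obtain ⟨i, hki, hil⟩ := exists_third h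
  have h1 := congrArg (fun x => idem α k * x * idem α l) hrel
  simp only [sum_of_distinct _ hki hil h, mul_add, add_mul, mul_sub, sub_mul, mul_zero,
    zero_mul] at h1
  simp only [← mul_assoc, idem_mul_self, idem_mul_of_ne α h, idem_mul_of_ne α hki,
    zero_mul] at h1
  simp only [mul_assoc, idem_mul_self, idem_mul_of_ne α h, idem_mul_of_ne α hil,
    mul_zero] at h1
  simpa [map_sub, mul_sub, sub_mul, mul_assoc, sub_eq_add_neg, mul_add, add_mul] using h1

include hm hrel in
lemma idem_mul_map_mul_idem {k l : Fin 3} (h : k ≠ l) (f : Fin 3 → F) :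
    idem α k * β f * idem α l = (f ⬝ᵥ coeff m k l) • unit α β m k l := by
  have hc := hm.coeff_ne_zero k l h 0
  have h1 := idem_mul_diff_mul_idem hrel h
  have hf : coeff m k l 0 • f = (f ⬝ᵥ coeff m k l) • Pi.single 0 1
      + (f 1 - f 2) • (m k - m l)
      + (f 2 * (m k - m l) 1 - f 1 * (m k - m l) 2) • (1 : Fin 3 → F) := by
    ext j
    fin_cases j <;>
      simp [dotProduct, Fin.sum_univ_three, coeff, crossOne] <;> ring
  have h2 := congrArg (fun x => idem α k * β x * idem α l) hf
  simp only [map_add, map_smul, map_one, mul_add, add_mul, mul_smul_comm, smul_mul_assoc, h1,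
    mul_one, idem_mul_of_ne α h, smul_zero, add_zero] at h2
  rw [unit, smul_comm, show idem β 0 = β (Pi.single 0 1) from rfl, ← h2, inv_smul_smul₀ hc]

include hm hrel in
lemma exists_unit_mul_unit {k i l : Fin 3} (hki : k ≠ i) (hil : i ≠ l) (hkl : k ≠ l) :
    ∃ w : F, w ≠ 0 ∧ unit α β m k i * unit α β m i l = w • unit α β m k l := by
  have hD := hm.dot_ne_zero k i l hki hil hkl
  set φ := m k - m l with hφ
  set D := φ ⬝ᵥ coeff m k i with hDdef
  have h0 := idem_mul_diff_mul_idem hrel hkl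
  have h1 := idem_mul_map_mul_idem hm hrel hkl (φ * φ)
  have hw : (φ * φ) ⬝ᵥ coeff m k l
      = -(coeff m k l 0 * coeff m k l 1 * coeff m k l 2) := by
    simp only [dotProduct, Fin.sum_univ_three, coeff, crossOne, ← hφ]
    simp; ring
  have h2 : idem α k * β (φ * φ) * idem α l
      = (idem α k * β φ * idem α i) * (idem α i * β φ * idem α l) := by
    rw [map_mul, ← mul_assoc, mul_assoc, mul_eq_sum_idem α _ _ hki hil hkl, h0]
    have : idem α k * β φ * idem α k * (β φ * idem α l) = 0 := by
      rw [mul_assoc, ← mul_assoc (idem α k) (β φ), h0, mul_zero]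
    rw [this, zero_mul, zero_add, add_zero]
    simp only [mul_assoc]
    rw [← mul_assoc (idem α i) (idem α i), idem_mul_self]
  rw [idem_mul_map_mul_idem hm hrel hki, idem_mul_map_mul_idem hm hrel hil,
    dot_coeff_right, h1, hw, smul_mul_smul_comm, ← hDdef] at h2
  have hD2 : D * -D ≠ 0 := mul_ne_zero hD (neg_ne_zero.2 hD)
  refine ⟨(D * -D)⁻¹ * -(coeff m k l 0 * coeff m k l 1 * coeff m k l 2),
    mul_ne_zero (inv_ne_zero hD2) (neg_ne_zero.2 ?_), ?_⟩
  · simp only [ne_eq, mul_eq_zero, hm.coeff_ne_zero k l hkl, or_self, not_false_eq_true]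
  · rw [mul_smul, h2, inv_smul_smul₀ hD2]

include hm hrel in
lemma exists_idem_mul_diff_mul_unit {k l : Fin 3} (hkl : k ≠ l) :
    ∃ s : F, idem α k * β (m k - m l) * unit α β m k l = s • unit α β m k l := by
  obtain ⟨i, hki, hil⟩ := exists_third hkl
  obtain ⟨w, -, hw⟩ := exists_unit_mul_unit hm hrel hki hil hkl
  have hc := hm.coeff_ne_zero k l hkl 0
  have h0 := idem_mul_diff_mul_idem hrel hkl
  have hq := idem_mul_map_mul_idem hm hrel hkl (Pi.single 0 1)
  have hqi := idem_mul_map_mul_idem hm hrel hil (Pi.single 0 1)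
  have hi := idem_mul_map_mul_idem hm hrel hki (m k - m l)
  have hp := idem_mul_map_mul_idem hm hrel hkl ((m k - m l) * Pi.single 0 1)
  rw [map_mul, ← mul_assoc, mul_assoc, mul_eq_sum_idem α _ _ hki hil hkl, h0, zero_mul,
    add_zero, hi, ← unit_mul_idem k i, smul_mul_assoc, mul_assoc (unit α β m k i),
    ← mul_assoc (idem α i), hqi, mul_smul_comm, hw, mul_assoc (idem α k * β (m k - m l)),
    ← mul_assoc (idem α k) (β (Pi.single 0 1)), hq, single_one_dotProduct, mul_smul_comm,
    smul_smul, smul_smul, ← eq_sub_iff_add_eq, ← sub_smul] at hp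
  exact ⟨_, by rw [← inv_smul_smul₀ hc (idem α k * _ * _), hp, smul_smul]⟩

include hm hrel in
lemma exists_idem_mul_map_mul_unit {k l : Fin 3} (hkl : k ≠ l) (f : Fin 3 → F) :
    ∃ s : F, idem α k * β f * unit α β m k l = s • unit α β m k l := by
  obtain ⟨i, hki, hil⟩ := exists_third hkl
  obtain ⟨w, hw0, hw⟩ := exists_unit_mul_unit hm hrel hki hil hkl
  have hD := hm.dot_ne_zero k i l hki hil hkl
  obtain ⟨s, hs⟩ := exists_idem_mul_diff_mul_unit hm hrel hkl
  obtain ⟨t, ht⟩ := exists_idem_mul_diff_mul_unit hm hrel hki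
  replace ht : idem α k * β (m k - m i) * unit α β m k l = t • unit α β m k l := by
    have := congrArg (fun x => w⁻¹ • (x * unit α β m i l)) ht
    simpa only [mul_assoc, smul_mul_assoc, hw, mul_smul_comm, smul_smul, mul_comm t,
      inv_mul_cancel₀ hw0, one_smul, inv_mul_cancel_left₀ hw0] using this
  set φ := m k - m l with hφ
  set ψ := m k - m i with hψ
  have hf : (φ ⬝ᵥ coeff m k i) • f = (f ⬝ᵥ coeff m k i) • φ - (f ⬝ᵥ coeff m k l) • ψ
      + (f ⬝ᵥ (crossProduct φ ψ)) • (1 : Fin 3 → F) := by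
    ext j
    simp only [dotProduct, Fin.sum_univ_three, coeff, crossOne, ← hφ, ← hψ, cross_apply]
    fin_cases j <;> simp <;> ring
  have h2 := congrArg (fun x => (φ ⬝ᵥ coeff m k i)⁻¹ • (idem α k * β x * unit α β m k l)) hf
  simp only [map_add, map_sub, map_smul, map_one, mul_add, mul_sub, sub_mul, add_mul,
    mul_smul_comm, smul_mul_assoc, mul_one, idem_mul_unit, hs, ht, inv_smul_smul₀ hD] at h2
  simp only [smul_smul, ← sub_smul, ← add_smul] at h2
  exact ⟨_, h2⟩

/-- The `k`-th diagonal product of two units. -/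
def diag (α β : (Fin 3 → F) →ₐ[F] R) (m : Fin 3 → Fin 3 → F) (k : Fin 3) : R :=
  unit α β m k (k + 1) * unit α β m (k + 1) k

include hm hrel in
lemma exists_unit_mul_unit_swap {k l l' : Fin 3} (hl : k ≠ l) (hl' : k ≠ l') :
    ∃ s : F, unit α β m k l * unit α β m l k
      = s • (unit α β m k l' * unit α β m l' k) := by
  by_cases h : l = l'
  · subst h; exact ⟨1, (one_smul _ _).symm⟩
  obtain ⟨w, hw0, hw⟩ := exists_unit_mul_unit hm hrel hl' (Ne.symm h) hl
  obtain ⟨v, -, hv⟩ := exists_unit_mul_unit hm hrel (Ne.symm h) hl.symm hl'.symm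
  refine ⟨w⁻¹ * v, ?_⟩
  rw [← inv_smul_smul₀ hw0 (unit α β m k l), ← hw, smul_mul_assoc, mul_assoc, hv,
    mul_smul_comm, smul_smul]

lemma ne_add_one (k : Fin 3) : k ≠ k + 1 := by decide +revert

include hm hrel in
lemma exists_unit_mul_unit_eq_diag {k l : Fin 3} (hl : k ≠ l) :
    ∃ s : F, unit α β m k l * unit α β m l k = s • diag α β m k :=
  exists_unit_mul_unit_swap hm hrel hl (ne_add_one k)

end

/-- A spanning family of cardinality 18. -/
def spanning (α β : (Fin 3 → F) →ₐ[F] R) (m : Fin 3 → Fin 3 → F) :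
    (Fin 3 × Fin 3) ⊕ (Fin 3 × Fin 3) → R
  | .inl (k, j) => idem α k * idem β j * idem α k
  | .inr (k, l) => if k = l then diag α β m k else unit α β m k l

/-- The span of the family `spanning`. -/
def spanningSpan (α β : (Fin 3 → F) →ₐ[F] R) (m : Fin 3 → Fin 3 → F) : Submodule F R :=
  Submodule.span F (Set.range (spanning α β m))

lemma corner_mem (k : Fin 3) (f : Fin 3 → F) :
    idem α k * β f * idem α k ∈ spanningSpan α β m := by
  have hf : f = ∑ j, f j • Pi.single j (1 : F) := pi_eq_sum_univ' f
  rw [hf]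
  simp only [map_sum, map_smul, Finset.mul_sum, Finset.sum_mul, mul_smul_comm, smul_mul_assoc]
  exact Submodule.sum_mem _ fun j _ => Submodule.smul_mem _ _ <|
    Submodule.subset_span ⟨.inl (k, j), rfl⟩

lemma diag_mem (k : Fin 3) : diag α β m k ∈ spanningSpan α β m :=
  Submodule.subset_span ⟨.inr (k, k), by simp [spanning]⟩

lemma unit_mem {k l : Fin 3} (h : k ≠ l) : unit α β m k l ∈ spanningSpan α β m :=
  Submodule.subset_span ⟨.inr (k, l), by simp [spanning, h]⟩

lemma one_mem_spanningSpan : (1 : R) ∈ spanningSpan α β m := by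
  rw [← sum_idem α]
  refine Submodule.sum_mem _ fun k _ => ?_
  simpa [idem_mul_self] using corner_mem (α := α) (β := β) (m := m) k 1

lemma idem_mul_mem (s : Fin 3) {x : R} (hx : x ∈ spanningSpan α β m) :
    idem α s * x ∈ spanningSpan α β m := by
  have key : ∀ (k : Fin 3) (y : R), idem α k * y ∈ spanningSpan α β m →
      idem α s * (idem α k * y) ∈ spanningSpan α β m := by
    intro k y hy
    by_cases h : s = k
    · subst h; rwa [← mul_assoc, idem_mul_self]
    · rw [← mul_assoc, idem_mul_of_ne α h, zero_mul]; exact zero_mem _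
  refine Submodule.span_induction (p := fun x _ => idem α s * x ∈ spanningSpan α β m)
    ?_ (by simp) (fun x y _ _ hx hy => by rw [mul_add]; exact add_mem hx hy)
    (fun a x _ hx => by rw [mul_smul_comm]; exact Submodule.smul_mem _ _ hx) hx
  rintro _ ⟨⟨k, j⟩ | ⟨k, l⟩, rfl⟩
  · simp only [spanning, mul_assoc]
    exact key k _ (by rw [← mul_assoc]; exact corner_mem k _)
  · by_cases h : k = l
    · simp only [spanning, h, if_true, diag]
      rw [← idem_mul_unit, mul_assoc]
      exact key l _ (by rw [← mul_assoc, idem_mul_unit]; exact diag_mem l)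
    · simp only [spanning, h, if_false]
      rw [← idem_mul_unit]
      exact key k _ (by rw [idem_mul_unit]; exact unit_mem h)

section

variable (hm : Generic m)
  (hrel : ∑ i, (idem α i * β (m i) - β (m i) * idem α i) = 0)

include hm hrel in
lemma unit_mul_unit_mem {k i l : Fin 3} (hki : k ≠ i) (hil : i ≠ l) :
    unit α β m k i * unit α β m i l ∈ spanningSpan α β m := by
  by_cases h : k = l
  · subst h
    obtain ⟨s, hs⟩ := exists_unit_mul_unit_eq_diag hm hrel hki
    rw [hs]
    exact Submodule.smul_mem _ _ (diag_mem k)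
  · obtain ⟨s, -, hs⟩ := exists_unit_mul_unit hm hrel hki hil h
    rw [hs]
    exact Submodule.smul_mem _ _ (unit_mem h)

lemma map_mul_eq_sum (f : Fin 3 → F) (y : R) : β f * y = ∑ s, idem α s * β f * y := by
  rw [← Finset.sum_mul, ← Finset.sum_mul, sum_idem, one_mul]

include hm hrel in
lemma idem_mul_map_mul_unit_mem {k l : Fin 3} (hkl : k ≠ l) (s : Fin 3) (f : Fin 3 → F) :
    idem α s * β f * unit α β m k l ∈ spanningSpan α β m := by
  by_cases h : s = k
  · subst h
    obtain ⟨t, ht⟩ := exists_idem_mul_map_mul_unit hm hrel hkl f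
    rw [ht]
    exact Submodule.smul_mem _ _ (unit_mem hkl)
  · rw [← idem_mul_unit, ← mul_assoc, idem_mul_map_mul_idem hm hrel h, smul_mul_assoc]
    exact Submodule.smul_mem _ _ (unit_mul_unit_mem hm hrel h hkl)

include hm hrel in
lemma exists_unit_mul_diag {s k : Fin 3} (h : s ≠ k) :
    ∃ t : F, unit α β m s k * diag α β m k = t • unit α β m s k := by
  obtain ⟨l, hsl, hlk⟩ := exists_third h
  obtain ⟨a, ha⟩ := exists_unit_mul_unit_swap hm hrel (ne_add_one k) hlk.symm
  obtain ⟨b, -, hb⟩ := exists_unit_mul_unit hm hrel h hlk.symm hsl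
  obtain ⟨c, -, hc⟩ := exists_unit_mul_unit hm hrel hsl hlk h
  exact ⟨a * (b * c), by
    rw [diag, ha, mul_smul_comm, ← mul_assoc, hb, smul_mul_assoc, hc, smul_smul, smul_smul,
      mul_assoc]⟩

include hm hrel in
lemma idem_mul_map_mul_diag_mem (k s : Fin 3) (f : Fin 3 → F) :
    idem α s * β f * diag α β m k ∈ spanningSpan α β m := by
  by_cases h : s = k
  · subst h
    obtain ⟨t, ht⟩ := exists_idem_mul_map_mul_unit hm hrel (ne_add_one s) f
    rw [diag, ← mul_assoc, ht, smul_mul_assoc]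
    exact Submodule.smul_mem _ _ (diag_mem s)
  · obtain ⟨t, ht⟩ := exists_unit_mul_diag hm hrel h
    have hd : diag α β m k = idem α k * diag α β m k := by
      rw [diag, ← mul_assoc, idem_mul_unit]
    rw [hd, ← mul_assoc, idem_mul_map_mul_idem hm hrel h, smul_mul_assoc, ht]
    exact Submodule.smul_mem _ _ (Submodule.smul_mem _ _ (unit_mem h))

include hm hrel in
lemma idem_mul_map_mul_idem_mul_map_mul_idem_mem (s k l : Fin 3) (hsk : s ≠ k) (hkl : k ≠ l)
    (f g : Fin 3 → F) :
    idem α s * β f * idem α k * β g * idem α l ∈ spanningSpan α β m := by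
  rw [idem_mul_map_mul_idem hm hrel hsk, smul_mul_assoc, smul_mul_assoc, ← unit_mul_idem,
    mul_assoc, mul_assoc, ← mul_assoc (idem α k), idem_mul_map_mul_idem hm hrel hkl,
    mul_smul_comm]
  exact Submodule.smul_mem _ _ (Submodule.smul_mem _ _ (unit_mul_unit_mem hm hrel hsk hkl))

include hm hrel in
lemma idem_mul_map_mul_idem_mem (s l : Fin 3) (f : Fin 3 → F) :
    idem α s * β f * idem α l ∈ spanningSpan α β m := by
  by_cases h : s = l
  · subst h; exact corner_mem s f
  · rw [idem_mul_map_mul_idem hm hrel h]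
    exact Submodule.smul_mem _ _ (unit_mem h)

include hm hrel in
lemma idem_mul_map_mul_corner_mem (k s : Fin 3) (f g : Fin 3 → F) :
    idem α s * β f * (idem α k * β g * idem α k) ∈ spanningSpan α β m := by
  have hfg := idem_mul_map_mul_idem_mem hm hrel s k (f * g)
  have hstep : ∀ i, k ≠ i → idem α s * β f * idem α i * (β g * idem α k)
      ∈ spanningSpan α β m := by
    intro i hi
    rw [← mul_assoc]
    by_cases h : s = i
    · subst h
      rw [mul_assoc, mul_assoc (idem α s * β f), ← mul_assoc (idem α s) (β g),
        idem_mul_map_mul_idem hm hrel hi.symm, mul_smul_comm]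
      exact Submodule.smul_mem _ _ (idem_mul_map_mul_unit_mem hm hrel hi.symm s f)
    · exact idem_mul_map_mul_idem_mul_map_mul_idem_mem hm hrel s i k h hi.symm f g
  obtain ⟨i, l, hki, hil, hkl⟩ : ∃ i l, k ≠ i ∧ i ≠ l ∧ k ≠ l := by
    clear hstep hfg; decide +revert
  rw [map_mul, ← mul_assoc, mul_assoc, mul_eq_sum_idem α _ _ hki hil hkl, add_assoc] at hfg
  have := (Submodule.add_mem_iff_left _ (add_mem (hstep i hki) (hstep l hkl))).1 hfg
  simpa only [mul_assoc] using this

include hm hrel in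
lemma map_mul_mem (f : Fin 3 → F) {x : R} (hx : x ∈ spanningSpan α β m) :
    β f * x ∈ spanningSpan α β m := by
  refine Submodule.span_induction (p := fun x _ => β f * x ∈ spanningSpan α β m)
    ?_ (by simp) (fun x y _ _ hx hy => by rw [mul_add]; exact add_mem hx hy)
    (fun a x _ hx => by rw [mul_smul_comm]; exact Submodule.smul_mem _ _ hx) hx
  rintro _ ⟨⟨k, j⟩ | ⟨k, l⟩, rfl⟩ <;> rw [map_mul_eq_sum (α := α)] <;>
    refine Submodule.sum_mem _ fun s _ => ?_
  · exact idem_mul_map_mul_corner_mem hm hrel k s f _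
  · by_cases h : k = l
    · simpa only [spanning, h, if_true] using idem_mul_map_mul_diag_mem hm hrel l s f
    · simpa only [spanning, h, if_false] using idem_mul_map_mul_unit_mem hm hrel h s f

lemma map_mul_mem_left (f : Fin 3 → F) {x : R} (hx : x ∈ spanningSpan α β m) :
    α f * x ∈ spanningSpan α β m := by
  have hf : f = ∑ j, f j • Pi.single j (1 : F) := pi_eq_sum_univ' f
  rw [hf]
  simp only [map_sum, map_smul, Finset.sum_mul, smul_mul_assoc]
  exact Submodule.sum_mem _ fun j _ => Submodule.smul_mem _ _ (idem_mul_mem j hx)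

include hm hrel in
/-- An algebra generated by two copies of `F³` satisfying a generic commutator relation has
dimension at most 18. -/
theorem rank_le (hgen : Algebra.adjoin F (Set.range α ∪ Set.range β) = ⊤) :
    Module.rank F R ≤ 18 := by
  have hmul : ∀ r : R, ∀ x ∈ spanningSpan α β m, r * x ∈ spanningSpan α β m := by
    intro r
    have hr : r ∈ Algebra.adjoin F (Set.range α ∪ Set.range β) := hgen ▸ Algebra.mem_top
    induction hr using Algebra.adjoin_induction with
    | mem r hr =>
      rcases hr with ⟨f, rfl⟩ | ⟨f, rfl⟩
      · exact fun x hx => map_mul_mem_left f hx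
      · exact fun x hx => map_mul_mem hm hrel f hx
    | algebraMap a =>
      intro x hx
      rw [← Algebra.smul_def]
      exact Submodule.smul_mem _ _ hx
    | add a b _ _ ha hb => exact fun x hx => by rw [add_mul]; exact add_mem (ha x hx) (hb x hx)
    | mul a b _ _ ha hb => exact fun x hx => by rw [mul_assoc]; exact ha _ (hb x hx)
  have htop : spanningSpan α β m = ⊤ := eq_top_iff.2 fun r _ => by
    simpa using hmul r 1 one_mem_spanningSpan
  rw [← rank_top F R, ← htop]
  refine (rank_span_le _).trans ?_
  classical
  rw [← Set.image_univ, ← Finset.coe_univ, ← Finset.coe_image]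
  refine (Cardinal.mk_coe_finset (s := Finset.univ.image (spanning α β m))).trans_le ?_
  exact_mod_cast Finset.card_image_le.trans_eq (by simp)

end

lemma sum_row_commutators (p q : Fin 3 → R) (a b c : F) :
    p 0 * ((1 : F) • q 0 + a • q 1 + (0 : F) • q 2)
        - ((1 : F) • q 0 + a • q 1 + (0 : F) • q 2) * p 0
      + (p 1 * (b • q 0 + c • q 1 + (0 : F) • q 2)
        - (b • q 0 + c • q 1 + (0 : F) • q 2) * p 1)
      + (p 2 * ((0 : F) • q 0 + (0 : F) • q 1 + (0 : F) • q 2)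
        - ((0 : F) • q 0 + (0 : F) • q 1 + (0 : F) • q 2) * p 2)
      = (p 0 * q 0 - q 0 * p 0) + a • (p 0 * q 1 - q 1 * p 0)
        + b • (p 1 * q 0 - q 0 * p 1) + c • (p 1 * q 1 - q 1 * p 1) := by
  simp only [one_smul, zero_smul, mul_add, add_mul, mul_smul_comm, smul_mul_assoc, smul_sub,
    mul_zero, zero_mul, add_zero]
  abel

lemma map_sum_commutator {S : Type*} [Ring S] [Algebra F S] (π : R →ₐ[F] S) (a b : Fin 3 → R) :
    π (∑ i, (a i * b i - b i * a i)) = ∑ i, (π (a i) * π (b i) - π (b i) * π (a i)) := by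
  simp only [map_sum, map_sub, map_mul]

open MvPolynomial in
/-- The coefficient matrix of the relation `Xrel`, over the polynomial ring. -/
noncomputable def relMatrix (k : Type) [Field k] : Fin 3 → Fin 3 → MvPolynomial (Fin 3) k :=
  ![![1, X 0, 0], ![X 1, X 2, 0], ![0, 0, 0]]

lemma generic_int : Generic (![![1, 2, 0], ![3, 1, 0], ![0, 0, 0]] : Fin 3 → Fin 3 → ℤ) where
  coeff_ne_zero := by decide
  dot_ne_zero := by decide

lemma generic_relMatrix (k : Type) [Field k] [CharZero k] : Generic (relMatrix k) := by
  refine Generic.of_map (MvPolynomial.eval ![2, 3, 1]) ?_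
  convert generic_int.map (g := Int.castRingHom k) Int.cast_injective using 3 with i j
  fin_cases i <;> fin_cases j <;> simp [relMatrix]

lemma adjoin_range_inl_union_range_inr (k A B : Type) [CommSemiring k] [Semiring A] [Semiring B]
    [Algebra k A] [Algebra k B] :
    Algebra.adjoin k (Set.range (inl k A B) ∪ Set.range (inr k A B)) = ⊤ := by
  set T := Algebra.adjoin k (Set.range (inl k A B) ∪ Set.range (inr k A B)) with hT
  have hmem : ∀ b x, LinearAlgebra.FreeProduct.ι k (fam A B) b x ∈ T := by
    rintro (_ | _) x
    · exact Algebra.subset_adjoin (Or.inr ⟨x, rfl⟩)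
    · exact Algebra.subset_adjoin (Or.inl ⟨x, rfl⟩)
  let f : ∀ {b}, fam A B b →ₐ[k] T := fun {b} =>
    (LinearAlgebra.FreeProduct.ι k (fam A B) b).codRestrict T (hmem b)
  let π : FP k A B →ₐ[k] T := LinearAlgebra.FreeProduct.lift k (fam A B) f
  have hπ : ∀ b, (T.val.comp π).comp (LinearAlgebra.FreeProduct.ι k (fam A B) b)
      = LinearAlgebra.FreeProduct.ι k (fam A B) b := by
    intro b
    rw [AlgHom.comp_assoc, LinearAlgebra.FreeProduct.lift_comp_ι]
    rfl
  have hid : T.val.comp π = AlgHom.id k _ :=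
    (LinearAlgebra.FreeProduct.lift_unique k (fam A B)
      (fun {b} => LinearAlgebra.FreeProduct.ι k (fam A B) b) _ hπ).trans
    (LinearAlgebra.FreeProduct.lift_unique k (fam A B)
      (fun {b} => LinearAlgebra.FreeProduct.ι k (fam A B) b) _ fun b => rfl).symm
  refine eq_top_iff.2 fun x _ => ?_
  have hx : (π x : FP k A B) = x := DFunLike.congr_fun hid x
  exact hx ▸ (π x).2

end CommutatorRelation

open CommutatorRelation

theorem statement2 (k : Type) [Field k] [IsAlgClosed k] [CharZero k] :
    Module.rank (Ffield k) (Salg k) ≤ 18 := by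
  let π : FP (Ffield k) (Fin 3 → Ffield k) (Fin 3 → Ffield k) →ₐ[Ffield k] Salg k :=
    RingQuot.mkAlgHom (Ffield k) _
  have hπ : Function.Surjective π := RingQuot.mkAlgHom_surjective _ _
  have hX : π (Xrel k) = 0 :=
    (RingQuot.mkAlgHom_rel (Ffield k) ⟨rfl, rfl⟩).trans (map_zero π)
  refine rank_le (α := π.comp (inl _ _ _)) (β := π.comp (inr _ _ _))
    (m := fun i j => algebraMap (MvPolynomial (Fin 3) k) (Ffield k) (relMatrix k i j))
    ((generic_relMatrix k).map (IsFractionRing.injective _ _)) ?_ ?_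
  · have hrow : ∀ i, inr (Ffield k) (Fin 3 → Ffield k) (Fin 3 → Ffield k)
        (fun j => algebraMap (MvPolynomial (Fin 3) k) (Ffield k) (relMatrix k i j))
        = ∑ j, algebraMap (MvPolynomial (Fin 3) k) (Ffield k) (relMatrix k i j) • qgen k j := by
      intro i
      simp only [qgen, ← map_smul, ← map_sum]
      exact congrArg _ (pi_eq_sum_univ' _)
    have hsum : ∑ i, (pgen k i * inr (Ffield k) (Fin 3 → Ffield k) (Fin 3 → Ffield k)
          (fun j => algebraMap (MvPolynomial (Fin 3) k) (Ffield k) (relMatrix k i j))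
        - inr (Ffield k) (Fin 3 → Ffield k) (Fin 3 → Ffield k)
          (fun j => algebraMap (MvPolynomial (Fin 3) k) (Ffield k) (relMatrix k i j))
          * pgen k i) = Xrel k := by
      simp only [hrow, Fin.sum_univ_three]
      simp only [relMatrix, Matrix.cons_val, map_one, map_zero]
      exact sum_row_commutators (pgen k) (qgen k) (yvar k 0) (yvar k 1) (yvar k 2)
    exact (map_sum_commutator π (pgen k) _).symm.trans ((congrArg π hsum).trans hX)
  · rw [AlgHom.coe_comp, AlgHom.coe_comp, Set.range_comp, Set.range_comp, ← Set.image_union,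
      Algebra.adjoin_image, adjoin_range_inl_union_range_inr, Algebra.map_top,
      (AlgHom.range_eq_top π).2 hπ]
end

section
/- The dimension of 𝒮 as a vector space over F is divisible by 3. -/
open scoped TensorProduct

set_option synthInstance.maxHeartbeats 1000000
set_option maxHeartbeats 1000000

/-- Two complete systems `p`, `q` of three orthogonal idempotents in `S` such that each
`p i * q 1 * p m` with `i ≠ m` is a generic multiple `t i m` of `p i * q 0 * p m`. -/
structure IdempotentPair {F S : Type*} [Field F] [Ring S] [Algebra F S]
    (p q : Fin 3 → S) (t : Fin 3 → Fin 3 → F) : Prop where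
  p_mul : ∀ i j, p i * p j = if i = j then p i else 0
  q_mul : ∀ i j, q i * q j = if i = j then q i else 0
  p_sum : ∑ i, p i = 1
  q_sum : ∑ i, q i = 1
  rel : ∀ i m, i ≠ m → p i * q 1 * p m = t i m • (p i * q 0 * p m)
  t_symm : ∀ i m, t i m = t m i
  t_ne : ∀ i m, i ≠ m → t i m ≠ 0
  t_add_one_ne : ∀ i m, i ≠ m → t i m + 1 ≠ 0
  t_inj : ∀ i l m, i ≠ l → l ≠ m → i ≠ m → t i l ≠ t i m

namespace IdempotentPair

variable {F S : Type*} [Field F] [Ring S] [Algebra F S] {p q : Fin 3 → S}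
  {t : Fin 3 → Fin 3 → F}

lemma exists_third : ∀ i m : Fin 3, ∃ l, i ≠ l ∧ l ≠ m := by decide

lemma sum_eq_of_distinct {M : Type*} [AddCommMonoid M] (f : Fin 3 → M) {i l m : Fin 3}
    (hil : i ≠ l) (hlm : l ≠ m) (him : i ≠ m) : ∑ j, f j = f i + f l + f m := by
  have h : (Finset.univ : Finset (Fin 3)) = {i, l, m} := by revert i l m; decide
  rw [h, Finset.sum_insert (by simp [*]), Finset.sum_pair hlm, add_assoc]

lemma p_self (h : IdempotentPair p q t) (i : Fin 3) : p i * p i = p i := by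
  simp [h.p_mul]

lemma mul_eq (h : IdempotentPair p q t) (a b : S) {i l m : Fin 3}
    (hil : i ≠ l) (hlm : l ≠ m) (him : i ≠ m) :
    a * b = a * p i * b + a * p l * b + a * p m * b := by
  rw [← add_mul, ← add_mul, ← mul_add, ← mul_add, ← sum_eq_of_distinct p hil hlm him, h.p_sum,
    mul_one]

lemma exists_smul (h : IdempotentPair p q t) {i m : Fin 3} (him : i ≠ m) (j : Fin 3) :
    ∃ a : F, p i * q j * p m = a • (p i * q 0 * p m) := by
  have h0 : p i * q 0 * p m + p i * q 1 * p m + p i * q 2 * p m = 0 := by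
    rw [← add_mul, ← add_mul, ← mul_add, ← mul_add, ← Fin.sum_univ_three, h.q_sum, mul_one,
      h.p_mul, if_neg him]
  fin_cases j
  · exact ⟨1, by simp⟩
  · exact ⟨_, h.rel i m him⟩
  · refine ⟨-(1 + t i m), ?_⟩
    rw [h.rel i m him] at h0
    rw [neg_smul, add_smul, one_smul]
    exact eq_neg_of_add_eq_zero_right h0

/-- The off-diagonal elements `p i * q 0 * p m` multiply like scaled matrix units. -/
lemma offdiag_mul (h : IdempotentPair p q t) {i l m : Fin 3}
    (hil : i ≠ l) (hlm : l ≠ m) (him : i ≠ m) :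
    ∃ c : F, c ≠ 0 ∧
      (p i * q 0 * p l) * (p l * q 0 * p m) = c • (p i * q 0 * p m) := by
  set τ := t i m with hτ
  set b : S := τ • q 0 - q 1 with hb
  have hbb : b * b = τ ^ 2 • q 0 + q 1 := by
    simp [hb, sub_mul, mul_sub, h.q_mul, smul_smul, pow_two]
  have hpb : ∀ x y, x ≠ y → p x * b * p y = (τ - t x y) • (p x * q 0 * p y) := by
    intro x y hxy
    simp [hb, mul_sub, sub_mul, h.rel x y hxy, sub_smul]
  have h1 : p i * b * p m = 0 := by rw [hpb i m him, ← hτ, sub_self, zero_smul]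
  have key : p i * (b * b) * p m = (p i * b * p l) * (p l * b * p m) := by
    have := h.mul_eq (p i * b) (b * p m) hil hlm him
    rw [h1, zero_mul, add_zero] at this
    have h2 : p i * b * p i * (b * p m) = 0 := by
      rw [mul_assoc _ (p i), ← mul_assoc (p i) b, h1, mul_zero]
    rw [h2, zero_add] at this
    calc p i * (b * b) * p m = p i * b * (b * p m) := by noncomm_ring
      _ = p i * b * (p l * p l) * (b * p m) := by rw [this, h.p_self]
      _ = _ := by noncomm_ring
  have lhs : p i * (b * b) * p m = (τ * (τ + 1)) • (p i * q 0 * p m) := by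
    rw [hbb, mul_add, add_mul, h.rel i m him, mul_smul_comm, smul_mul_assoc, ← add_smul]
    congr 1; ring
  rw [lhs, hpb i l hil, hpb l m hlm, smul_mul_smul_comm] at key
  have n1 : τ - t i l ≠ 0 := sub_ne_zero.2 (h.t_inj i l m hil hlm him).symm
  have n2 : τ - t l m ≠ 0 := by
    rw [hτ, h.t_symm i m, h.t_symm l m]
    exact sub_ne_zero.2 (h.t_inj m i l him.symm hil hlm.symm)
  have n3 : (τ - t i l) * (τ - t l m) ≠ 0 := mul_ne_zero n1 n2
  refine ⟨((τ - t i l) * (τ - t l m))⁻¹ * (τ * (τ + 1)), mul_ne_zero (inv_ne_zero n3)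
    (mul_ne_zero (h.t_ne i m him) (h.t_add_one_ne i m him)), ?_⟩
  rw [mul_smul, key, inv_smul_smul₀ n3]

lemma offdiag_mul_self (h : IdempotentPair p q t) {i m : Fin 3} (him : i ≠ m) :
    ∃ c : F, c ≠ 0 ∧ (p i * q 0 * p m) * ((p m * q 0 * p i) * (p i * q 0 * p m)) =
      c • (p i * q 0 * p m) := by
  obtain ⟨l, hil, hlm⟩ := exists_third i m
  obtain ⟨a, ha, ea⟩ := h.offdiag_mul hil hlm him
  obtain ⟨b, hb, eb⟩ := h.offdiag_mul him.symm hil hlm.symm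
  obtain ⟨c, hc, ec⟩ := h.offdiag_mul him hlm.symm hil
  refine ⟨b * c, mul_ne_zero hb hc, ?_⟩
  have e := congrArg (fun x => a⁻¹ • x) ea
  simp only [inv_smul_smul₀ ha] at e
  have : (p i * q 0 * p m) * ((p m * q 0 * p i) * ((p i * q 0 * p l) * (p l * q 0 * p m))) =
      (b * c * a) • (p i * q 0 * p m) := by
    rw [← mul_assoc (p m * q 0 * p i), eb, smul_mul_assoc, mul_smul_comm,
      ← mul_assoc (p i * q 0 * p m), ec, smul_mul_assoc, ea, smul_smul, smul_smul, mul_assoc]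
  nth_rewrite 2 [← e]
  rw [mul_smul_comm, mul_smul_comm, this, smul_smul]
  congr 1
  field_simp

variable (F p q) in
/-- The right ideal generated by the off-diagonal elements `p i * q 0 * p m`, `i ≠ m`. -/
def offdiagIdeal : Submodule F S :=
  Submodule.span F {x | ∃ i m s, i ≠ m ∧ x = p i * q 0 * p m * s}

lemma offdiag_mem {i m : Fin 3} (him : i ≠ m) (s : S) :
    p i * q 0 * p m * s ∈ offdiagIdeal F p q :=
  Submodule.subset_span ⟨i, m, s, him, rfl⟩

lemma mul_mem_offdiagIdeal (h : IdempotentPair p q t) {i m : Fin 3} (him : i ≠ m)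
    (j : Fin 3) (s : S) : p i * q j * p m * s ∈ offdiagIdeal F p q := by
  obtain ⟨a, ha⟩ := h.exists_smul him j
  rw [ha, smul_mul_assoc]
  exact Submodule.smul_mem _ _ (offdiag_mem him s)

lemma p_mul_mem (h : IdempotentPair p q t) (j : Fin 3) {x : S}
    (hx : x ∈ offdiagIdeal F p q) : p j * x ∈ offdiagIdeal F p q := by
  induction hx using Submodule.span_induction with
  | zero => simp
  | add x y _ _ hx hy => rw [mul_add]; exact add_mem hx hy
  | smul a x _ hx => rw [mul_smul_comm]; exact Submodule.smul_mem _ _ hx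
  | mem x hx =>
    obtain ⟨i, m, s, him, rfl⟩ := hx
    rw [← mul_assoc, ← mul_assoc, ← mul_assoc, h.p_mul]
    split_ifs with hj
    · subst hj; exact offdiag_mem him s
    · simp

lemma q_mul_mem (h : IdempotentPair p q t) (j : Fin 3) {x : S}
    (hx : x ∈ offdiagIdeal F p q) : q j * x ∈ offdiagIdeal F p q := by
  induction hx using Submodule.span_induction with
  | zero => simp
  | add x y _ _ hx hy => rw [mul_add]; exact add_mem hx hy
  | smul a x _ hx => rw [mul_smul_comm]; exact Submodule.smul_mem _ _ hx
  | mem x hx =>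
    obtain ⟨i, m, s, him, rfl⟩ := hx
    obtain ⟨l, hil, hlm⟩ := exists_third i m
    have e : q j * (p i * q 0 * p m * s) = p i * q j * p i * (q 0 * p m * s) +
        p l * q j * p i * (q 0 * p m * s) + p m * q j * p i * (q 0 * p m * s) := by
      have := h.mul_eq 1 (q j * (p i * q 0 * p m * s)) hil hlm him
      simpa [mul_assoc] using this
    have e2 : p i * q j * p i * (q 0 * p m * s) = p i * (q j * q 0) * p m * s
        - p i * q j * p l * (q 0 * p m * s) - p i * q j * p m * (q 0 * p m * s) := by
      have := h.mul_eq (p i * q j) (q 0 * p m * s) hil hlm him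
      rw [eq_sub_iff_add_eq, eq_sub_iff_add_eq, add_right_comm, ← this]
      noncomm_ring
    rw [e, e2, h.q_mul]
    refine add_mem (add_mem (sub_mem (sub_mem ?_ ?_) ?_) ?_) ?_
    · split_ifs
      · exact h.mul_mem_offdiagIdeal him _ _
      · simp
    · exact h.mul_mem_offdiagIdeal hil _ _
    · exact h.mul_mem_offdiagIdeal him _ _
    · exact h.mul_mem_offdiagIdeal hil.symm _ _
    · exact h.mul_mem_offdiagIdeal him.symm _ _

variable (F p q) in
/-- The span of the products `p i * q j` together with the off-diagonal ideal. -/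
def diagSpan : Submodule F S :=
  Submodule.span F (Set.range fun x : Fin 3 × Fin 3 => p x.1 * q x.2) ⊔ offdiagIdeal F p q

lemma mul_mem_diagSpan {a : S}
    (hN : ∀ x ∈ offdiagIdeal F p q, a * x ∈ offdiagIdeal F p q)
    (hpq : ∀ i j, a * (p i * q j) ∈ diagSpan F p q) {x : S} (hx : x ∈ diagSpan F p q) :
    a * x ∈ diagSpan F p q := by
  obtain ⟨y, hy, z, hz, rfl⟩ := Submodule.mem_sup.1 hx
  rw [mul_add]
  refine add_mem ?_ (Submodule.mem_sup_right (hN z hz))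
  clear hx
  induction hy using Submodule.span_induction with
  | zero => simp
  | add x y _ _ hx hy => rw [mul_add]; exact add_mem hx hy
  | smul a x _ hx => rw [mul_smul_comm]; exact Submodule.smul_mem _ _ hx
  | mem x hx =>
    obtain ⟨⟨i, j⟩, rfl⟩ := hx
    exact hpq i j

lemma pq_mem_diagSpan (i j : Fin 3) : p i * q j ∈ diagSpan F p q :=
  Submodule.mem_sup_left (Submodule.subset_span ⟨(i, j), rfl⟩)

lemma diagSpan_eq_top (h : IdempotentPair p q t)
    (hgen : Algebra.adjoin F (Set.range p ∪ Set.range q) = ⊤) : diagSpan F p q = ⊤ := by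
  have h1 : (1 : S) ∈ diagSpan F p q := by
    have : (1 : S) = ∑ i, ∑ j, p i * q j := by
      rw [← Finset.sum_mul_sum, h.p_sum, h.q_sum, mul_one]
    rw [this]
    exact sum_mem fun i _ => sum_mem fun j _ => pq_mem_diagSpan i j
  have hp : ∀ k, ∀ x ∈ diagSpan F p q, p k * x ∈ diagSpan F p q := fun k x hx => by
    refine mul_mem_diagSpan (fun x hx => h.p_mul_mem k hx) (fun i j => ?_) hx
    rw [← mul_assoc, h.p_mul]
    split_ifs
    · exact pq_mem_diagSpan _ _
    · simp
  have hq : ∀ k, ∀ x ∈ diagSpan F p q, q k * x ∈ diagSpan F p q := fun k x hx => by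
    refine mul_mem_diagSpan (fun x hx => h.q_mul_mem k hx) (fun i j => ?_) hx
    obtain ⟨m, him, -⟩ := exists_third i i
    obtain ⟨l, hil, hlm⟩ := exists_third i m
    have e : q k * (p i * q j) = p i * q k * p i * q j + p l * q k * p i * q j +
        p m * q k * p i * q j := by
      have := h.mul_eq 1 (q k * (p i * q j)) hil hlm him
      simpa [mul_assoc] using this
    have e2 : p i * q k * p i * q j = p i * (q k * q j)
        - p i * q k * p l * q j - p i * q k * p m * q j := by
      have := h.mul_eq (p i * q k) (q j) hil hlm him
      rw [eq_sub_iff_add_eq, eq_sub_iff_add_eq, add_right_comm, ← this, mul_assoc]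
    rw [e, e2, h.q_mul]
    refine add_mem (add_mem (sub_mem (sub_mem ?_ ?_) ?_) ?_) ?_
    · split_ifs
      · exact pq_mem_diagSpan _ _
      · simp
    all_goals refine Submodule.mem_sup_right (h.mul_mem_offdiagIdeal ?_ _ _)
    · exact hil
    · exact him
    · exact hil.symm
    · exact him.symm
  refine eq_top_iff.2 fun s _ => ?_
  have key : ∀ s ∈ Algebra.adjoin F (Set.range p ∪ Set.range q),
      ∀ x ∈ diagSpan F p q, s * x ∈ diagSpan F p q := by
    intro s hs
    induction hs using Algebra.adjoin_induction with
    | mem s hs =>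
      rcases hs with ⟨k, rfl⟩ | ⟨k, rfl⟩
      · exact hp k
      · exact hq k
    | algebraMap r =>
      intro x hx
      rw [← Algebra.smul_def]
      exact Submodule.smul_mem _ _ hx
    | add a b _ _ ha hb => intro x hx; rw [add_mul]; exact add_mem (ha x hx) (hb x hx)
    | mul a b _ _ ha hb => intro x hx; rw [mul_assoc]; exact ha _ (hb x hx)
  simpa using key s (hgen ▸ Algebra.mem_top) 1 h1

lemma ker_eq_offdiagIdeal (h : IdempotentPair p q t)
    (hgen : Algebra.adjoin F (Set.range p ∪ Set.range q) = ⊤)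
    (φ : S →ₐ[F] (Fin 3 × Fin 3 → F)) (hφ : ∀ i j, φ (p i * q j) = Pi.single (i, j) 1) :
    LinearMap.ker φ.toLinearMap = offdiagIdeal F p q := by
  have hle : offdiagIdeal F p q ≤ LinearMap.ker φ.toLinearMap := by
    refine Submodule.span_le.2 ?_
    rintro _ ⟨i, m, s, him, rfl⟩
    have : φ (p i * q 0 * p m * s) = φ (p i * p m * (q 0 * s)) := by
      simp only [map_mul]; ring
    simp [h.p_mul, him, -map_mul, this]
  refine le_antisymm (fun s hs => ?_) hle
  have hs' : s ∈ diagSpan F p q := h.diagSpan_eq_top hgen ▸ Submodule.mem_top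
  obtain ⟨y, hy, z, hz, rfl⟩ := Submodule.mem_sup.1 hs'
  obtain ⟨c, rfl⟩ := (Submodule.mem_span_range_iff_exists_fun F).1 hy
  have hz' : φ z = 0 := hle hz
  have hc : φ (∑ x, c x • (p x.1 * q x.2)) = c := by
    simp only [map_sum, map_smul, hφ]
    ext x
    simp [Finset.sum_apply, Pi.single_apply]
  have hs0 : φ (∑ x, c x • (p x.1 * q x.2) + z) = 0 := hs
  rw [map_add, hc, hz', add_zero] at hs0
  simpa [hs0] using hz

lemma p_zero_mul (h : IdempotentPair p q t) {r : S}
    (hr : r ∈ LinearMap.range (LinearMap.mulLeft F (p 0 * q 0 * p 1))) : p 0 * r = r := by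
  obtain ⟨s, rfl⟩ := hr
  simp only [LinearMap.mulLeft_apply, ← mul_assoc, h.p_self]

lemma exists_smul_of_mem_range (h : IdempotentPair p q t) {i : Fin 3} (hi : i ≠ 0) :
    ∃ c : F, c ≠ 0 ∧ ∀ r ∈ LinearMap.range (LinearMap.mulLeft F (p 0 * q 0 * p 1)),
      (p 0 * q 0 * p i) * ((p i * q 0 * p 0) * r) = c • r := by
  obtain ⟨c, hc, e⟩ := h.offdiag_mul_self hi.symm
  refine ⟨c, hc, fun r hr => ?_⟩
  obtain ⟨s, rfl⟩ : ∃ s, r = p 0 * q 0 * p i * s := by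
    obtain ⟨s, rfl⟩ := hr
    by_cases hi1 : i = 1
    · exact ⟨s, by rw [hi1, LinearMap.mulLeft_apply]⟩
    · obtain ⟨d, hd, e'⟩ := h.offdiag_mul hi.symm hi1 zero_ne_one
      refine ⟨d⁻¹ • (p i * q 0 * p 1 * s), ?_⟩
      rw [LinearMap.mulLeft_apply, mul_smul_comm, ← mul_assoc, e', smul_mul_assoc,
        inv_smul_smul₀ hd]
  rw [← mul_assoc (p i * q 0 * p 0), ← mul_assoc, e, smul_mul_assoc]

lemma offdiag_mul_mem_range (h : IdempotentPair p q t) {m : Fin 3} (hm : 0 ≠ m) (s : S) :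
    p 0 * q 0 * p m * s ∈ LinearMap.range (LinearMap.mulLeft F (p 0 * q 0 * p 1)) := by
  by_cases hm1 : m = 1
  · subst hm1; exact ⟨s, rfl⟩
  · obtain ⟨d, hd, e⟩ := h.offdiag_mul zero_ne_one (Ne.symm hm1) hm
    refine ⟨d⁻¹ • (p 1 * q 0 * p m * s), ?_⟩
    rw [LinearMap.mulLeft_apply, mul_smul_comm, ← mul_assoc, e, smul_mul_assoc,
      inv_smul_smul₀ hd]

lemma three_dvd_finrank_offdiagIdeal (h : IdempotentPair p q t) [Module.Finite F S] :
    3 ∣ Module.finrank F (offdiagIdeal F p q) := by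
  let R := LinearMap.range (LinearMap.mulLeft F (p 0 * q 0 * p 1))
  let w : Fin 3 → S := fun i => if i = 0 then p 0 else p i * q 0 * p 0
  have hw : ∀ i j, p i * w j = if i = j then w j else 0 := by
    intro i j
    simp only [w]
    split_ifs <;> simp_all [← mul_assoc, h.p_mul]
  let Ψ : (Fin 3 → R) →ₗ[F] S :=
    ∑ i, LinearMap.mulLeft F (w i) ∘ₗ R.subtype ∘ₗ LinearMap.proj i
  have hΨ : ∀ f, Ψ f = ∑ i, w i * (f i : S) := fun f => by simp [Ψ]
  have hinj : Function.Injective Ψ := by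
    rw [← LinearMap.ker_eq_bot, LinearMap.ker_eq_bot']
    intro f hf
    ext i
    have h1 : w i * (f i : S) = 0 := by
      have := congrArg (p i * ·) (hΨ f)
      simpa [hf, Finset.mul_sum, ← mul_assoc, hw, ite_mul] using this.symm
    by_cases hi : i = 0
    · subst hi
      simpa [w, h.p_zero_mul (f 0).2] using h1
    · obtain ⟨c, hc, e⟩ := h.exists_smul_of_mem_range hi
      have := e _ (f i).2
      simp only [w, if_neg hi] at h1
      rw [h1, mul_zero] at this
      simpa [hc] using this.symm
  have hsingle : ∀ i, ∀ r ∈ R, w i * r ∈ LinearMap.range Ψ := fun i r hr => by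
    refine ⟨Pi.single i ⟨r, hr⟩, ?_⟩
    rw [hΨ, Finset.sum_eq_single i] <;> simp +contextual
  have hrange : LinearMap.range Ψ = offdiagIdeal F p q := by
    apply le_antisymm
    · rintro _ ⟨f, rfl⟩
      rw [hΨ]
      refine sum_mem fun i _ => ?_
      by_cases hi : i = 0
      · subst hi
        simp only [w, if_true, h.p_zero_mul (f 0).2]
        obtain ⟨s, hs⟩ := (f 0).2
        rw [← hs]
        exact offdiag_mem zero_ne_one s
      · simp only [w, if_neg hi]
        exact offdiag_mem hi _
    · refine Submodule.span_le.2 ?_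
      rintro _ ⟨i, m, s, him, rfl⟩
      by_cases hi : i = 0
      · subst hi
        have hr := h.offdiag_mul_mem_range him s
        rw [← h.p_zero_mul hr]
        simpa [w] using hsingle 0 _ hr
      · have hwi : w i = p i * q 0 * p 0 := by simp [w, hi]
        by_cases hm : m = 0
        · subst hm
          obtain ⟨c, hc, e⟩ := h.offdiag_mul_self him
          have := hsingle i _ (h.offdiag_mul_mem_range (Ne.symm hi) (p i * q 0 * p 0 * s))
          have e' : w i * (p 0 * q 0 * p i * (p i * q 0 * p 0 * s)) =
              c • (p i * q 0 * p 0 * s) := by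
            rw [hwi, ← smul_mul_assoc, ← e]
            simp only [mul_assoc]
          rw [e'] at this
          exact (Submodule.smul_mem_iff _ hc).1 this
        · obtain ⟨c, hc, e⟩ := h.offdiag_mul hi (Ne.symm hm) him
          have := hsingle i _ (h.offdiag_mul_mem_range (Ne.symm hm) s)
          rw [hwi, ← mul_assoc, e, smul_mul_assoc] at this
          exact (Submodule.smul_mem_iff _ hc).1 this
  rw [← hrange, LinearMap.finrank_range_of_inj hinj, Module.finrank_pi_fintype]
  simp

/-- An algebra generated by such a pair, with all nine characters, has dimension divisible
by three. -/
theorem three_dvd_finrank (h : IdempotentPair p q t)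
    (hgen : Algebra.adjoin F (Set.range p ∪ Set.range q) = ⊤)
    (φ : S →ₐ[F] (Fin 3 × Fin 3 → F)) (hφ : ∀ i j, φ (p i * q j) = Pi.single (i, j) 1) :
    3 ∣ Module.finrank F S := by
  by_cases hfin : Module.Finite F S
  swap
  · simp [Module.finrank_of_not_finite hfin]
  have hsurj : LinearMap.range φ.toLinearMap = ⊤ := by
    refine eq_top_iff.2 fun c _ => ⟨∑ x, c x • (p x.1 * q x.2), ?_⟩
    simp only [AlgHom.toLinearMap_apply, map_sum, map_smul, hφ]
    ext x
    simp [Finset.sum_apply, Pi.single_apply]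
  rw [← LinearMap.finrank_range_add_finrank_ker φ.toLinearMap, hsurj,
    h.ker_eq_offdiagIdeal hgen φ hφ, finrank_top, Module.finrank_pi]
  exact dvd_add (by simp) h.three_dvd_finrank_offdiagIdeal

end IdempotentPair

/-- The relation `X = 0` for generic coefficients `y` yields an `IdempotentPair`. -/
lemma IdempotentPair.of_commutator_relation {F S : Type*} [Field F] [Ring S] [Algebra F S]
    {p q : Fin 3 → S} (y : Fin 3 → F)
    (p_mul : ∀ i j, p i * p j = if i = j then p i else 0)
    (q_mul : ∀ i j, q i * q j = if i = j then q i else 0)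
    (p_sum : ∑ i, p i = 1) (q_sum : ∑ i, q i = 1)
    (hX : (p 0 * q 0 - q 0 * p 0) + y 0 • (p 0 * q 1 - q 1 * p 0)
      + y 1 • (p 1 * q 0 - q 0 * p 1) + y 2 • (p 1 * q 1 - q 1 * p 1) = 0)
    (h0 : y 0 ≠ 0) (h1 : y 1 ≠ 0) (h2 : y 2 ≠ 0) (h01 : y 0 - 1 ≠ 0) (h11 : y 1 - 1 ≠ 0)
    (h02 : y 0 - y 2 ≠ 0) (h21 : y 2 - y 1 ≠ 0) (hs : y 0 + y 1 - y 2 - 1 ≠ 0)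
    (hd : y 0 * y 1 - y 2 ≠ 0) :
    ∃ t : Fin 3 → Fin 3 → F, IdempotentPair p q t := by
  have comm : ∀ i m a j, p i * (p a * q j - q j * p a) * p m =
      ((if i = a then 1 else 0) - (if a = m then 1 else 0) : F) • (p i * q j * p m) := by
    intro i m a j
    have e : p i * (p a * q j - q j * p a) * p m =
        (p i * p a) * q j * p m - p i * q j * (p a * p m) := by noncomm_ring
    rw [e, p_mul, p_mul]
    split_ifs <;> simp_all
  have lin : ∀ i m : Fin 3,
      (((if i = 0 then 1 else 0) - (if 0 = m then 1 else 0)) * (1 : F)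
        + ((if i = 1 then 1 else 0) - (if 1 = m then 1 else 0)) * y 1) • (p i * q 0 * p m) +
      (((if i = 0 then 1 else 0) - (if 0 = m then 1 else 0)) * y 0
        + ((if i = 1 then 1 else 0) - (if 1 = m then 1 else 0)) * y 2) • (p i * q 1 * p m)
        = 0 := by
    intro i m
    have := congrArg (fun x => p i * x * p m) hX
    simp only [mul_add, add_mul, mul_smul_comm, smul_mul_assoc, comm, mul_zero, zero_mul] at this
    rw [← this]
    module
  have solve : ∀ (a b : F) (u v : S), b ≠ 0 → a • u + b • v = 0 → v = (-a / b) • u := by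
    intro a b u v hb h
    rw [div_eq_inv_mul, mul_smul, neg_smul, neg_eq_of_add_eq_zero_right h, inv_smul_smul₀ hb]
  set a := (y 1 - 1) / (y 0 - y 2) with ha
  set b := -1 / y 0 with hb
  set c := -y 1 / y 2 with hc
  have ha0 : a ≠ 0 := div_ne_zero h11 h02
  have hb0 : b ≠ 0 := div_ne_zero (by simp) h0
  have hc0 : c ≠ 0 := div_ne_zero (by simpa) h2
  have ha1 : a + 1 ≠ 0 := by
    rw [ha, div_add_one h02]
    exact div_ne_zero (by convert hs using 1; ring) h02
  have hb1 : b + 1 ≠ 0 := by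
    rw [hb, div_add_one h0]
    exact div_ne_zero (by convert h01 using 1; ring) h0
  have hc1 : c + 1 ≠ 0 := by
    rw [hc, div_add_one h2]
    exact div_ne_zero (by convert h21 using 1; ring) h2
  have hab : a ≠ b := by
    rw [ha, hb, Ne, div_eq_div_iff h02 h0]
    intro h; apply hd; linear_combination h
  have hac : a ≠ c := by
    rw [ha, hc, Ne, div_eq_div_iff h02 h2]
    intro h; apply hd; linear_combination h
  have hbc : b ≠ c := by
    rw [hb, hc, Ne, div_eq_div_iff h0 h2]
    intro h; apply hd; linear_combination h
  refine ⟨![![0, a, b], ![a, 0, c], ![b, c, 0]], p_mul, q_mul, p_sum, q_sum, ?_, ?_, ?_, ?_, ?_⟩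
  · intro i m him
    have hl := lin i m
    fin_cases i <;> fin_cases m <;> simp at him hl ⊢
    · refine (solve (1 - y 1) (y 0 - y 2) _ _ h02 ?_).trans (by rw [ha, neg_sub])
      rw [← hl]; module
    · exact solve 1 (y 0) _ _ h0 (by rw [← hl]; module)
    · refine (solve (1 - y 1) (y 0 - y 2) _ _ h02 ?_).trans (by rw [ha, neg_sub])
      rw [← neg_eq_zero, ← hl]; module
    · exact solve (y 1) (y 2) _ _ h2 hl
    · refine solve 1 (y 0) _ _ h0 ?_
      rw [← neg_eq_zero, ← hl]; module
    · refine solve (y 1) (y 2) _ _ h2 ?_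
      rw [← neg_eq_zero, ← hl]; module
  · intro i m; fin_cases i <;> fin_cases m <;> rfl
  all_goals try
    intro i m him
    fin_cases i <;> fin_cases m <;>
      first
      | exact absurd rfl him
      | assumption
  · intro i l m hil hlm him
    fin_cases i <;> fin_cases l <;> fin_cases m <;>
      first
      | exact absurd rfl hil
      | exact absurd rfl hlm
      | exact absurd rfl him
      | exact hab
      | exact hab.symm
      | exact hac
      | exact hac.symm
      | exact hbc
      | exact hbc.symm

lemma algebraMap_fractionRing_ne_zero {k : Type} [Field k] (P : MvPolynomial (Fin 3) k)
    (x : Fin 3 → k) (hx : MvPolynomial.eval x P ≠ 0) :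
    algebraMap (MvPolynomial (Fin 3) k) (Ffield k) P ≠ 0 := by
  rw [Ne, IsFractionRing.to_map_eq_zero_iff]
  rintro rfl
  simp at hx

lemma adjoin_range_inl_union_range_inr (F A B : Type) [CommRing F] [Ring A] [Ring B]
    [Algebra F A] [Algebra F B] :
    Algebra.adjoin F (Set.range (inl F A B) ∪ Set.range (inr F A B)) = ⊤ := by
  refine eq_top_iff.2 fun x _ => ?_
  obtain ⟨y, rfl⟩ := RingCon.mk'_surjective (c := LinearAlgebra.FreeProduct.ringCon F (fam A B)) x
  induction y using TensorAlgebra.induction with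
  | algebraMap r => exact Subalgebra.algebraMap_mem _ r
  | mul a b ha hb => rw [map_mul]; exact mul_mem (ha trivial) (hb trivial)
  | add a b ha hb => rw [map_add]; exact add_mem (ha trivial) (hb trivial)
  | ι m =>
    induction m using DirectSum.induction_on with
    | zero => simp
    | add x y hx hy => rw [map_add, map_add]; exact add_mem (hx trivial) (hy trivial)
    | of i x =>
      have e : RingCon.mk' (LinearAlgebra.FreeProduct.ringCon F (fam A B))
          (TensorAlgebra.ι F (DirectSum.of (fam A B) i x)) =
          LinearAlgebra.FreeProduct.ι F (fam A B) i x := by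
        rw [LinearAlgebra.FreeProduct.ι_def]; rfl
      rw [e]
      cases i
      · exact Algebra.subset_adjoin (Or.inr ⟨x, rfl⟩)
      · exact Algebra.subset_adjoin (Or.inl ⟨x, rfl⟩)

lemma exists_FP_lift {F A B C : Type} [CommRing F] [Ring A] [Ring B] [Ring C]
    [Algebra F A] [Algebra F B] [Algebra F C] (f : A →ₐ[F] C) (g : B →ₐ[F] C) :
    ∃ φ : FP F A B →ₐ[F] C, (∀ a, φ (inl F A B a) = f a) ∧ ∀ b, φ (inr F A B b) = g b := by
  let maps : {i : Bool} → fam A B i →ₐ[F] C := fun {i} => match i with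
    | true => f
    | false => g
  refine ⟨LinearAlgebra.FreeProduct.lift F (fam A B) maps, fun a => ?_, fun b => ?_⟩
  · exact DFunLike.congr_fun
      (LinearAlgebra.FreeProduct.lift_comp_ι F (fam A B) maps (i := true)) a
  · exact DFunLike.congr_fun
      (LinearAlgebra.FreeProduct.lift_comp_ι F (fam A B) maps (i := false)) b

theorem statement3 (k : Type) [Field k] [IsAlgClosed k] [CharZero k] :
    3 ∣ Module.finrank (Ffield k) (Salg k) := by
  let F := Ffield k
  let r : FP F (Fin 3 → F) (Fin 3 → F) → FP F (Fin 3 → F) (Fin 3 → F) → Prop :=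
    fun u v => u = Xrel k ∧ v = 0
  let π : FP F (Fin 3 → F) (Fin 3 → F) →ₐ[F] Salg k := RingQuot.mkAlgHom F r
  have hπ : Function.Surjective π := RingQuot.mkAlgHom_surjective F r
  have π_sub : ∀ a b, π (a - b) = π a - π b := fun a b => by
    rw [eq_sub_iff_add_eq, ← map_add]
    exact congrArg π (sub_add_cancel a b)
  let y : Fin 3 → F := yvar k
  have single_mul : ∀ i j : Fin 3, (Pi.single i 1 * Pi.single j 1 : Fin 3 → F) =
      if i = j then Pi.single i 1 else 0 := by
    intro i j
    split_ifs with h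
    · subst h; rw [← Pi.single_mul, mul_one]
    · ext x
      simp only [Pi.mul_apply, Pi.single_apply, Pi.zero_apply]
      split_ifs <;> simp_all
  have single_sum : ∑ i, (Pi.single i 1 : Fin 3 → F) = 1 := by
    ext x; simp [Finset.sum_apply, Pi.single_apply]
  obtain ⟨t, ht⟩ : ∃ t, IdempotentPair (F := F)
      (fun i => π (pgen k i)) (fun i => π (qgen k i)) t := by
    have ne : ∀ (P : MvPolynomial (Fin 3) k) (x : Fin 3 → k), MvPolynomial.eval x P ≠ 0 →
        algebraMap (MvPolynomial (Fin 3) k) F P ≠ 0 := algebraMap_fractionRing_ne_zero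
    refine IdempotentPair.of_commutator_relation y ?_ ?_ ?_ ?_ ?_ ?_ ?_ ?_ ?_ ?_ ?_ ?_ ?_ ?_
    · intro i j
      simp only [pgen, ← map_mul, single_mul]
      split_ifs <;> simp
    · intro i j
      simp only [qgen, ← map_mul, single_mul]
      split_ifs <;> simp
    · simp only [pgen, ← map_sum, single_sum, map_one]
    · simp only [qgen, ← map_sum, single_sum, map_one]
    · have : π (Xrel k) = π 0 := RingQuot.mkAlgHom_rel F (s := r) ⟨rfl, rfl⟩
      rw [map_zero] at this
      simpa only [Xrel, map_add, π_sub, map_mul, map_smul] using this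
    · exact ne (.X 0) 1 (by simp)
    · exact ne (.X 1) 1 (by simp)
    · exact ne (.X 2) 1 (by simp)
    · simpa [y, yvar] using ne (.X 0 - 1) 0 (by simp)
    · simpa [y, yvar] using ne (.X 1 - 1) 0 (by simp)
    · simpa [y, yvar] using ne (.X 0 - .X 2) ![1, 0, 0] (by simp)
    · simpa [y, yvar] using ne (.X 2 - .X 1) ![0, 1, 0] (by simp)
    · simpa [y, yvar] using ne (.X 0 + .X 1 - .X 2 - 1) 0 (by simp)
    · simpa [y, yvar] using ne (.X 0 * .X 1 - .X 2) ![0, 0, 1] (by simp)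
  obtain ⟨ψ, hψl, hψr⟩ := exists_FP_lift
    (AlgHom.pi (A := fun _ : Fin 3 × Fin 3 => F) fun x => Pi.evalAlgHom F (fun _ : Fin 3 => F) x.1)
    (AlgHom.pi (A := fun _ : Fin 3 × Fin 3 => F) fun x => Pi.evalAlgHom F (fun _ : Fin 3 => F) x.2)
  have hψ : ∀ ⦃u v⦄, r u v → ψ u = ψ v := by
    rintro _ _ ⟨rfl, rfl⟩
    simp [Xrel, mul_comm]
  have hgen : Algebra.adjoin F (Set.range (fun i => π (pgen k i)) ∪
      Set.range (fun i => π (qgen k i))) = ⊤ := by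
    have hp : ∀ i, π (pgen k i) ∈ Algebra.adjoin F (Set.range (fun i => π (pgen k i)) ∪
        Set.range (fun i => π (qgen k i))) := fun i =>
      Algebra.subset_adjoin (Set.mem_union_left _ (Set.mem_range_self i))
    have hq : ∀ i, π (qgen k i) ∈ Algebra.adjoin F (Set.range (fun i => π (pgen k i)) ∪
        Set.range (fun i => π (qgen k i))) := fun i =>
      Algebra.subset_adjoin (Set.mem_union_right _ (Set.mem_range_self i))
    rw [← AlgHom.range_eq_top] at hπ
    rw [eq_top_iff, ← hπ, ← Algebra.map_top, ← adjoin_range_inl_union_range_inr,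
      AlgHom.map_adjoin]
    refine Algebra.adjoin_le ?_
    have pi : ∀ a : Fin 3 → F, a = ∑ i, a i • Pi.single i 1 := fun a => by
      ext x; simp [Finset.sum_apply, Pi.single_apply]
    rintro _ ⟨_, ⟨a, rfl⟩ | ⟨a, rfl⟩, rfl⟩
    · rw [pi a, map_sum, map_sum]
      refine sum_mem fun i _ => ?_
      rw [map_smul, map_smul]
      exact Subalgebra.smul_mem _ (hp i) _
    · rw [pi a, map_sum, map_sum]
      refine sum_mem fun i _ => ?_
      rw [map_smul, map_smul]
      exact Subalgebra.smul_mem _ (hq i) _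
  refine ht.three_dvd_finrank hgen (RingQuot.liftAlgHom F ⟨ψ, hψ⟩) fun i j => ?_
  rw [← map_mul]
  refine (RingQuot.liftAlgHom_mkAlgHom_apply F ψ hψ _).trans ?_
  rw [map_mul, pgen, qgen, hψl, hψr]
  ext ⟨a, b⟩
  simp [Pi.single_apply, ← ite_and, and_comm]
end

section
/- The algebra 𝒮 is finite-dimensional as an F-vector space, and dim_F 𝒮 ≤ 19. -/
open scoped TensorProduct

set_option synthInstance.maxHeartbeats 1000000
set_option maxHeartbeats 1000000

/-- The indices `i`, `j`, `m` are pairwise distinct, so they exhaust `Fin 3`. -/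
def Distinct3 (i j m : Fin 3) : Prop := i ≠ j ∧ i ≠ m ∧ j ≠ m

instance (i j m : Fin 3) : Decidable (Distinct3 i j m) :=
  inferInstanceAs (Decidable (i ≠ j ∧ i ≠ m ∧ j ≠ m))

namespace Distinct3

variable {i j m : Fin 3}

theorem rotate (h : Distinct3 i j m) : Distinct3 j m i := ⟨h.2.2, h.1.symm, h.2.1.symm⟩

theorem swap (h : Distinct3 i j m) : Distinct3 j i m := ⟨h.1.symm, h.2.2, h.2.1⟩

theorem sum_eq {V : Type*} [AddCommMonoid V] (h : Distinct3 i j m) (f : Fin 3 → V) :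
    ∑ x, f x = f i + f j + f m := by
  have hu : (Finset.univ : Finset (Fin 3)) = {i, j, m} := by revert i j m; decide
  rw [hu, Finset.sum_insert (by simp [h.1, h.2.1]), Finset.sum_pair h.2.2, add_assoc]

theorem prod_eq {V : Type*} [CommMonoid V] (h : Distinct3 i j m) (f : Fin 3 → V) :
    ∏ x, f x = f i * f j * f m := by
  have hu : (Finset.univ : Finset (Fin 3)) = {i, j, m} := by revert i j m; decide
  rw [hu, Finset.prod_insert (by simp [h.1, h.2.1]), Finset.prod_pair h.2.2, mul_assoc]

theorem eq_third (h : Distinct3 i j m) : m = -(i + j) := by revert i j m; decide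

theorem of_ne (h : i ≠ j) : Distinct3 i j (-(i + j)) := by revert i j; decide

theorem add_one_add_two (i : Fin 3) : Distinct3 i (i + 1) (i + 2) := by revert i; decide

end Distinct3

/-- The quartic form `∑ₗ M i l * M m l * M j k * M j n`, where `{i, j, m} = {l, k, n} = Fin 3`. -/
def quarticForm {F : Type*} [CommRing F] (M : Fin 3 → Fin 3 → F) (j : Fin 3) : F :=
  ∑ l, M (j + 1) l * M (j + 2) l * (M j (l + 1) * M j (l + 2))

theorem quarticForm_eq {F : Type*} [CommRing F] (M : Fin 3 → Fin 3 → F) {i j m : Fin 3}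
    (h : Distinct3 i j m) :
    quarticForm M j = ∑ l, M i l * M m l * (M j (l + 1) * M j (l + 2)) := by
  obtain ⟨rfl, rfl⟩ | ⟨rfl, rfl⟩ : (i = j + 1 ∧ m = j + 2) ∨ (i = j + 2 ∧ m = j + 1) := by
    revert i j m; decide
  · rfl
  · exact Finset.sum_congr rfl fun l _ => by ring

section PairOfDecompositions

variable {F S : Type*} [Field F] [Ring S] [Algebra F S]

/-- Two complete families of orthogonal idempotents `p`, `q` whose words `pᵢ qₖ pⱼ` and `qₖ pᵢ qₗ`
are governed by a matrix `M`: the element `pᵢ qₖ pⱼ` equals `M m k • tᵢⱼ`, where `m` is the third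
index, and `qₖ pᵢ qₗ` is proportional to `M i n`, where `n` is the third index. -/
structure Interlaced (M : Fin 3 → Fin 3 → F) (p q : Fin 3 → S) (t : Fin 3 → Fin 3 → S) :
    Prop where
  p_idem : CompleteOrthogonalIdempotents p
  q_idem : CompleteOrthogonalIdempotents q
  ne_zero : ∀ i k, M i k ≠ 0
  p_mul_t : ∀ i j, p i * t i j = t i j
  t_mul_p : ∀ i j, t i j * p j = t i j
  pqp : ∀ {i j m}, Distinct3 i j m → ∀ k, p i * q k * p j = M m k • t i j
  qpq : ∀ {k l n}, Distinct3 k l n → ∀ j m,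
    M m n • (q k * p j * q l) = M j n • (q k * p m * q l)

namespace Interlaced

variable {M : Fin 3 → Fin 3 → F} {p q : Fin 3 → S} {t : Fin 3 → Fin 3 → S}

theorem t_mul_q_mul_p (H : Interlaced M p q t) {i j r s : Fin 3} (h : Distinct3 j r s)
    (l : Fin 3) : t i j * q l * p r = M s l • (t i j * t j r) := by
  rw [← H.t_mul_p i j, mul_assoc (t i j), mul_assoc, H.pqp h l, mul_smul_comm, H.t_mul_p]

theorem smul_t_mul_q (H : Interlaced M p q t) {i j m k l n : Fin 3} (h : Distinct3 i j m)
    (h' : Distinct3 k l n) :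
    (M m k * M m n) • (t i j * q l) = (M j k * M j n) • (t i m * q l) := by
  have h1 : p i * q k * p j * q l = M m k • (t i j * q l) := by
    rw [H.pqp h, smul_mul_assoc]
  have h2 : p i * q k * p m * q l = M j k • (t i m * q l) := by
    rw [H.pqp h.swap.rotate, smul_mul_assoc]
  have h3 := congrArg (p i * ·) (H.qpq h' j m)
  simp only [mul_smul_comm, ← mul_assoc] at h3
  rw [h1, h2, smul_smul, smul_smul] at h3
  rw [mul_comm, h3, mul_comm]

theorem prod_smul_t_mul_t (H : Interlaced M p q t) {i j m : Fin 3} (h : Distinct3 i j m) :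
    (∏ l, M m l) • (t i j * t j i) = (∏ l, M j l) • (t i m * t m i) := by
  have h0 := congrArg (· * p i)
    (H.smul_t_mul_q h (show Distinct3 2 1 0 by decide))
  have hd : Distinct3 0 1 2 := by decide
  simp only [smul_mul_assoc] at h0
  rw [H.t_mul_q_mul_p h.swap, H.t_mul_q_mul_p h.rotate.rotate, smul_smul, smul_smul] at h0
  rw [hd.prod_eq, hd.prod_eq]
  convert h0 using 2 <;> ring

theorem prod_smul_t (H : Interlaced M p q t) {i j m : Fin 3} (h : Distinct3 i j m) :
    (∏ l, M m l) • t i j = quarticForm M j • (t i m * t m j) := by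
  have key : ∀ l, (∏ l, M m l) • (t i j * q l * p j) =
      (M i l * M m l * (M j (l + 1) * M j (l + 2))) • (t i m * t m j) := fun l => by
    have hd := Distinct3.add_one_add_two l
    have h0 := congrArg (M m l • · * p j) (H.smul_t_mul_q h hd.swap)
    simp only [smul_mul_assoc] at h0
    rw [H.t_mul_q_mul_p h.rotate.swap, smul_smul, smul_smul, smul_smul] at h0
    rw [hd.prod_eq]
    convert h0 using 2 <;> ring
  have hs : t i j = ∑ l, t i j * q l * p j := by
    rw [← Finset.sum_mul, ← Finset.mul_sum, H.q_idem.complete, mul_one, H.t_mul_p]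
  rw [quarticForm_eq M h, Finset.sum_smul]
  conv_lhs => rw [hs, Finset.smul_sum]
  exact Finset.sum_congr rfl fun l _ => key l

variable (t) in
/-- A spanning family for the noncommutative part: `tᵢⱼ` off the diagonal, and
`tᵢₘ * tₘᵢ` with `m = i + 1` on the diagonal. -/
def core (x : Fin 3 × Fin 3) : S :=
  if x.1 = x.2 then t x.1 (x.1 + 1) * t (x.1 + 1) x.1 else t x.1 x.2

variable (F t) in
/-- The span of `core`. -/
def coreSpan : Submodule F S := Submodule.span F (Set.range (core t))

theorem t_mem (t : Fin 3 → Fin 3 → S) {i j : Fin 3} (h : i ≠ j) : t i j ∈ coreSpan F t :=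
  Submodule.subset_span ⟨(i, j), by simp [core, h]⟩

theorem t_mul_t_swap_mem (H : Interlaced M p q t) {i j : Fin 3} (h : i ≠ j) :
    t i j * t j i ∈ coreSpan F t := by
  have hg : t i (i + 1) * t (i + 1) i ∈ coreSpan F t :=
    Submodule.subset_span ⟨(i, i), by simp [core]⟩
  obtain rfl | rfl : j = i + 1 ∨ j = i + 2 := by
    clear hg; revert i j; decide
  · exact hg
  · have h1 := H.prod_smul_t_mul_t (Distinct3.add_one_add_two i)
    have h2 : ∏ l, M (i + 1) l ≠ 0 := Finset.prod_ne_zero_iff.2 fun l _ => H.ne_zero _ l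
    rw [← (coreSpan F t).smul_mem_iff h2, ← h1]
    exact Submodule.smul_mem _ _ hg

theorem t_mul_t_mem (H : Interlaced M p q t) (hM : ∀ j, quarticForm M j ≠ 0) {i j m : Fin 3}
    (h : Distinct3 i j m) : t i m * t m j ∈ coreSpan F t := by
  rw [← (coreSpan F t).smul_mem_iff (hM j), ← H.prod_smul_t h]
  exact Submodule.smul_mem _ _ (t_mem t h.1)

theorem t_mul_t_mul_t_mem (H : Interlaced M p q t) (hM : ∀ j, quarticForm M j ≠ 0)
    {i j m : Fin 3} (h : Distinct3 i j m) : t i j * (t j m * t m j) ∈ coreSpan F t := by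
  have h1 := congrArg (· * t m j) (H.prod_smul_t h.swap.rotate)
  simp only [smul_mul_assoc, mul_assoc] at h1
  rw [← (coreSpan F t).smul_mem_iff (hM m), ← h1]
  exact Submodule.smul_mem _ _ (H.t_mul_t_mem hM h)

theorem t_mul_mem (H : Interlaced M p q t) (hM : ∀ j, quarticForm M j ≠ 0) {i j : Fin 3}
    (h : i ≠ j) {x : S} (hx : x ∈ coreSpan F t) : t i j * x ∈ coreSpan F t := by
  induction hx using Submodule.span_induction with
  | zero => simp
  | add x y _ _ hx hy => rw [mul_add]; exact add_mem hx hy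
  | smul c x _ hx => rw [mul_smul_comm]; exact Submodule.smul_mem _ _ hx
  | mem x hx =>
    obtain ⟨⟨a, b⟩, rfl⟩ := hx
    by_cases hja : j = a
    · subst hja
      by_cases hjb : j = b
      · subst hjb
        have hd := Distinct3.of_ne h
        have key := H.t_mul_t_mul_t_mem hM hd
        have h2 : ∏ l, M (j + 1) l ≠ 0 := Finset.prod_ne_zero_iff.2 fun l _ => H.ne_zero _ l
        obtain hm | hm : -(i + j) = j + 1 ∨ -(i + j) = j + 2 := by
          clear * - h; revert i j; decide
        · simpa [core, hm] using key
        · have h3 := H.prod_smul_t_mul_t (Distinct3.add_one_add_two j)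
          have h4 : ∏ l, M (j + 2) l ≠ 0 := Finset.prod_ne_zero_iff.2 fun l _ => H.ne_zero _ l
          rw [hm] at key
          simp only [core, if_true]
          rw [← (coreSpan F t).smul_mem_iff h4, ← mul_smul_comm, h3, mul_smul_comm]
          exact Submodule.smul_mem _ _ key
      · simp only [core, hjb, if_false]
        by_cases hib : i = b
        · subst hib
          exact H.t_mul_t_swap_mem h
        · exact H.t_mul_t_mem hM ⟨hib, h, Ne.symm hjb⟩
    · have h0 : t i j * core t (a, b) = 0 := by
        have ha : ∀ c y, t i j * (t a c * y) = 0 := fun c y => by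
          rw [← H.t_mul_p i j, ← H.p_mul_t a c, mul_assoc, mul_assoc, ← mul_assoc (p j),
            H.p_idem.ortho hja, zero_mul, mul_zero]
        rw [core]
        split_ifs
        · exact ha _ _
        · simpa using ha b 1
      rw [h0]
      exact zero_mem _

theorem t_mul_q_mem (H : Interlaced M p q t) (hM : ∀ j, quarticForm M j ≠ 0) {i j : Fin 3}
    (h : i ≠ j) (l : Fin 3) : t i j * q l ∈ coreSpan F t := by
  have hd := Distinct3.of_ne h
  set m := -(i + j)
  have hl := Distinct3.add_one_add_two l
  rw [← mul_one (t i j * q l), ← H.p_idem.complete, Finset.mul_sum, hd.sum_eq,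
    H.t_mul_q_mul_p hd.swap, H.t_mul_q_mul_p hd.rotate]
  refine add_mem (add_mem (Submodule.smul_mem _ _ (H.t_mul_t_swap_mem h)) ?_)
    (Submodule.smul_mem _ _ (H.t_mul_t_mem hM hd.swap.rotate))
  rw [← (coreSpan F t).smul_mem_iff (mul_ne_zero (H.ne_zero m (l + 1)) (H.ne_zero m (l + 2))),
    ← smul_mul_assoc, H.smul_t_mul_q hd hl.swap, smul_mul_assoc,
    H.t_mul_q_mul_p hd.rotate.swap]
  exact Submodule.smul_mem _ _ (Submodule.smul_mem _ _ (H.t_mul_t_mem hM hd))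

theorem mul_q_mem (H : Interlaced M p q t) (hM : ∀ j, quarticForm M j ≠ 0) {x : S}
    (hx : x ∈ coreSpan F t) (l : Fin 3) : x * q l ∈ coreSpan F t := by
  induction hx using Submodule.span_induction with
  | zero => simp
  | add x y _ _ hx hy => rw [add_mul]; exact add_mem hx hy
  | smul c x _ hx => rw [smul_mul_assoc]; exact Submodule.smul_mem _ _ hx
  | mem x hx =>
    obtain ⟨⟨a, b⟩, rfl⟩ := hx
    by_cases hab : a = b
    · simp only [core, hab, if_true, mul_assoc]
      have hb := (Distinct3.add_one_add_two b).1
      exact H.t_mul_mem hM hb (H.t_mul_q_mem hM hb.symm l)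
    · simp only [core, hab, if_false]
      exact H.t_mul_q_mem hM hab l

theorem mul_p_mem (H : Interlaced M p q t) {x : S}
    (hx : x ∈ coreSpan F t) (j : Fin 3) : x * p j ∈ coreSpan F t := by
  induction hx using Submodule.span_induction with
  | zero => simp
  | add x y _ _ hx hy => rw [add_mul]; exact add_mem hx hy
  | smul c x _ hx => rw [smul_mul_assoc]; exact Submodule.smul_mem _ _ hx
  | mem x hx =>
    obtain ⟨⟨a, b⟩, rfl⟩ := hx
    have hb : core t (a, b) * p b = core t (a, b) := by
      rw [core]
      split_ifs with hab
      · simp only at hab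
        rw [mul_assoc, ← hab, H.t_mul_p]
      · exact H.t_mul_p a b
    by_cases hbj : b = j
    · rw [← hbj, hb]
      exact Submodule.subset_span ⟨_, rfl⟩
    · rw [← hb, mul_assoc, H.p_idem.ortho hbj, mul_zero]
      exact zero_mem _

variable (p q t) in
/-- The products `pᵢ qₖ` together with `core`. -/
def spanningFamily : (Fin 3 × Fin 3) ⊕ (Fin 3 × Fin 3) → S :=
  Sum.elim (fun x => p x.1 * q x.2) (core t)

theorem coreSpan_le (p q : Fin 3 → S) (t : Fin 3 → Fin 3 → S) :
    coreSpan F t ≤ Submodule.span F (Set.range (spanningFamily p q t)) :=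
  Submodule.span_mono (by rintro _ ⟨x, rfl⟩; exact ⟨Sum.inr x, rfl⟩)

theorem p_mul_q_mem (p q : Fin 3 → S) (t : Fin 3 → Fin 3 → S) (i k : Fin 3) :
    p i * q k ∈ Submodule.span F (Set.range (spanningFamily p q t)) :=
  Submodule.subset_span ⟨Sum.inl (i, k), rfl⟩

theorem p_mul_q_mul_p_mem (H : Interlaced M p q t) (i k j : Fin 3) :
    p i * q k * p j ∈ Submodule.span F (Set.range (spanningFamily p q t)) := by
  have hne : ∀ {j}, i ≠ j →
      p i * q k * p j ∈ Submodule.span F (Set.range (spanningFamily p q t)) := fun {j} h => by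
    rw [H.pqp (Distinct3.of_ne h)]
    exact coreSpan_le p q t (Submodule.smul_mem _ _ (t_mem t h))
  by_cases h : i = j
  · subst h
    have hd := Distinct3.add_one_add_two i
    have h1 : p i * q k * p i =
        p i * q k - p i * q k * p (i + 1) - p i * q k * p (i + 2) := by
      conv_rhs => enter [1, 1]; rw [← mul_one (p i * q k), ← H.p_idem.complete, hd.sum_eq]
      noncomm_ring
    rw [h1]
    exact sub_mem (sub_mem (p_mul_q_mem p q t i k) (hne hd.1)) (hne hd.2.1)
  · exact hne h

theorem span_spanningFamily (H : Interlaced M p q t) (hM : ∀ j, quarticForm M j ≠ 0)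
    (hgen : Algebra.adjoin F (Set.range p ∪ Set.range q) = ⊤) :
    Submodule.span F (Set.range (spanningFamily p q t)) = ⊤ := by
  set N := Submodule.span F (Set.range (spanningFamily p q t))
  have hp : ∀ j, ∀ x ∈ N, x * p j ∈ N := fun j x hx => by
    induction hx using Submodule.span_induction with
    | zero => simp
    | add x y _ _ hx hy => rw [add_mul]; exact add_mem hx hy
    | smul c x _ hx => rw [smul_mul_assoc]; exact Submodule.smul_mem _ _ hx
    | mem x hx =>
      obtain ⟨x | x, rfl⟩ := hx
      · exact H.p_mul_q_mul_p_mem x.1 x.2 j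
      · exact coreSpan_le p q t (H.mul_p_mem (Submodule.subset_span ⟨x, rfl⟩) j)
  have hq : ∀ l, ∀ x ∈ N, x * q l ∈ N := fun l x hx => by
    induction hx using Submodule.span_induction with
    | zero => simp
    | add x y _ _ hx hy => rw [add_mul]; exact add_mem hx hy
    | smul c x _ hx => rw [smul_mul_assoc]; exact Submodule.smul_mem _ _ hx
    | mem x hx =>
      obtain ⟨x | x, rfl⟩ := hx
      · simp only [spanningFamily, Sum.elim_inl, mul_assoc, H.q_idem.mul_eq]
        split_ifs
        · exact p_mul_q_mem p q t x.1 x.2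
        · simp
      · exact coreSpan_le p q t (H.mul_q_mem hM (Submodule.subset_span ⟨x, rfl⟩) l)
  have hone : (1 : S) ∈ N := by
    rw [← mul_one (1 : S)]
    nth_rw 1 [← H.p_idem.complete]
    rw [← H.q_idem.complete, Finset.sum_mul_sum]
    exact sum_mem fun i _ => sum_mem fun k _ => p_mul_q_mem p q t i k
  have hmul : ∀ y : S, ∀ x ∈ N, x * y ∈ N := fun y => by
    have hy : y ∈ Algebra.adjoin F (Set.range p ∪ Set.range q) := hgen ▸ Algebra.mem_top
    induction hy using Algebra.adjoin_induction with
    | mem y hy =>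
      rcases hy with ⟨j, rfl⟩ | ⟨l, rfl⟩
      · exact hp j
      · exact hq l
    | algebraMap r =>
      intro x hx
      rw [← Algebra.commutes, ← Algebra.smul_def]
      exact Submodule.smul_mem _ _ hx
    | add y z _ _ hy hz => intro x hx; rw [mul_add]; exact add_mem (hy x hx) (hz x hx)
    | mul y z _ _ hy hz => intro x hx; rw [← mul_assoc]; exact hz _ (hy x hx)
  exact eq_top_iff.2 fun y _ => by simpa using hmul y 1 hone

end Interlaced

/-- The alternating `2 × 2` differences of a `3 × 3` array. -/
def alternatingDiff {R : Type*} [Ring R] (a : Fin 3 → Fin 3 → R) (m k : Fin 3) : R :=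
  a (m + 1) (k + 1) - a (m + 2) (k + 1) - (a (m + 1) (k + 2) - a (m + 2) (k + 2))

theorem smul_eq_smul_of_sum_eq_zero {V : Type*} [AddCommGroup V] [Module F V] {e : Fin 3 → V}
    {c : Fin 3 → F} (he : ∑ k, e k = 0) (hc : ∑ k, c k • e k = 0) (k l : Fin 3) :
    (c (l + 1) - c (l + 2)) • e k = (c (k + 1) - c (k + 2)) • e l := by
  by_cases h : k = l
  · rw [h]
  have hd := Distinct3.of_ne h
  set n := -(k + l)
  rw [hd.sum_eq] at he hc
  have hn : e n = -e k - e l := by linear_combination (norm := module) (1 : F) • he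
  rw [hn] at hc
  obtain ⟨h1, h2, h3, h4⟩ | ⟨h1, h2, h3, h4⟩ :
      (l + 1 = n ∧ l + 2 = k ∧ k + 1 = l ∧ k + 2 = n) ∨
      (l + 1 = k ∧ l + 2 = n ∧ k + 1 = n ∧ k + 2 = l) := by
    clear * - h; revert k l; decide
  · rw [h1, h2, h3, h4]
    linear_combination (norm := module) (-1 : F) • hc
  · rw [h1, h2, h3, h4]
    linear_combination (norm := module) (1 : F) • hc

theorem alternatingDiff_smul {p q : Fin 3 → S} (hp : CompleteOrthogonalIdempotents p)
    (hq : CompleteOrthogonalIdempotents q) {a : Fin 3 → Fin 3 → F}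
    (hX : ∑ i, ∑ k, a i k • (p i * q k - q k * p i) = 0) {i j m : Fin 3} (h : Distinct3 i j m)
    (k l : Fin 3) :
    alternatingDiff a m l • (p i * q k * p j) = alternatingDiff a m k • (p i * q l * p j) := by
  have h1 : ∑ k, p i * q k * p j = 0 := by
    rw [← Finset.sum_mul, ← Finset.mul_sum, hq.complete, mul_one, hp.ortho h.1]
  have h2 : ∑ k, (a i k - a j k) • (p i * q k * p j) = 0 := by
    have h3 := congrArg (p i * · * p j) hX
    simp only [Finset.mul_sum, Finset.sum_mul, mul_smul_comm, smul_mul_assoc, mul_sub, sub_mul,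
      mul_zero, zero_mul] at h3
    rw [Finset.sum_comm] at h3
    rw [← h3]
    refine Finset.sum_congr rfl fun k _ => ?_
    have h4 : ∀ r, a r k • (p i * (p r * q k) * p j - p i * (q k * p r) * p j) =
        (if i = r then a r k • (p i * q k * p j) else 0) -
        (if r = j then a r k • (p i * q k * p j) else 0) := fun r => by
      rw [← mul_assoc, hp.mul_eq, mul_assoc (p i), mul_assoc (q k), hp.mul_eq, smul_sub]
      split_ifs with h5 h6 h6 <;> simp_all [mul_assoc]
    simp only [h4, Finset.sum_sub_distrib, Finset.sum_ite_eq, Finset.sum_ite_eq',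
      Finset.mem_univ, if_true, sub_smul]
  have key := smul_eq_smul_of_sum_eq_zero (c := fun k => a i k - a j k) h1 h2 k l
  obtain ⟨rfl, rfl⟩ | ⟨rfl, rfl⟩ : (i = m + 1 ∧ j = m + 2) ∨ (i = m + 2 ∧ j = m + 1) := by
    clear * - h; revert i j m; decide
  · exact key
  · have hneg : ∀ x, alternatingDiff a m x = -((a (m + 2) (x + 1) - a (m + 1) (x + 1)) -
        (a (m + 2) (x + 2) - a (m + 1) (x + 2))) := fun x => by rw [alternatingDiff]; ring
    rw [hneg, hneg, neg_smul, neg_smul, key]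

theorem exists_interlaced {p q : Fin 3 → S} (hp : CompleteOrthogonalIdempotents p)
    (hq : CompleteOrthogonalIdempotents q) {a : Fin 3 → Fin 3 → F}
    (hX : ∑ i, ∑ k, a i k • (p i * q k - q k * p i) = 0)
    (ha : ∀ m k, alternatingDiff a m k ≠ 0) :
    ∃ t, Interlaced (alternatingDiff a) p q t := by
  refine ⟨fun i j => (alternatingDiff a (-(i + j)) 0)⁻¹ • (p i * q 0 * p j), hp, hq, ha,
    fun i j => ?_, fun i j => ?_, fun {i j m} h k => ?_, fun {k l n} h j m => ?_⟩
  · rw [mul_smul_comm, ← mul_assoc, ← mul_assoc, (hp.idem i).eq]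
  · rw [smul_mul_assoc, mul_assoc, (hp.idem j).eq]
  · rw [← h.eq_third, smul_smul, mul_comm, ← smul_smul, ← alternatingDiff_smul hp hq hX h k 0,
      inv_smul_smul₀ (ha m 0)]
  · have hX' : ∑ k, ∑ i, a i k • (q k * p i - p i * q k) = 0 := by
      rw [Finset.sum_comm, ← neg_eq_zero, ← Finset.sum_neg_distrib]
      simpa only [← Finset.sum_neg_distrib, ← smul_neg, neg_sub] using hX
    have ht : ∀ i, alternatingDiff (fun k i => a i k) n i = alternatingDiff a i n := fun i => by
      simp only [alternatingDiff]; ring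
    simpa only [ht] using alternatingDiff_smul hq hp hX' h j m

theorem finite_and_finrank_le {p q : Fin 3 → S} (hp : CompleteOrthogonalIdempotents p)
    (hq : CompleteOrthogonalIdempotents q) {a : Fin 3 → Fin 3 → F}
    (hX : ∑ i, ∑ k, a i k • (p i * q k - q k * p i) = 0)
    (ha : ∀ m k, alternatingDiff a m k ≠ 0) (ha' : ∀ j, quarticForm (alternatingDiff a) j ≠ 0)
    (hgen : Algebra.adjoin F (Set.range p ∪ Set.range q) = ⊤) :
    Module.Finite F S ∧ Module.finrank F S ≤ 18 := by
  obtain ⟨t, H⟩ := exists_interlaced hp hq hX ha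
  have hs := H.span_spanningFamily ha' hgen
  refine ⟨Module.Finite.of_fg_top (hs ▸ Submodule.fg_span (Set.finite_range _)), ?_⟩
  have h := finrank_range_le_card (R := F) (Interlaced.spanningFamily p q t)
  rw [Set.finrank, hs, finrank_top] at h
  simpa using h

end PairOfDecompositions

theorem FP.adjoin_range_eq_top (k A B : Type) [CommSemiring k] [Semiring A] [Semiring B]
    [Algebra k A] [Algebra k B] :
    Algebra.adjoin k (Set.range (inl k A B) ∪ Set.range (inr k A B)) = ⊤ := by
  set U := Algebra.adjoin k (Set.range (inl k A B) ∪ Set.range (inr k A B))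
  let f : ∀ {b : Bool}, fam A B b →ₐ[k] U := fun {b} =>
    (LinearAlgebra.FreeProduct.ι k (fam A B) b).codRestrict U fun x =>
      Algebra.subset_adjoin (by cases b; exacts [Or.inr ⟨x, rfl⟩, Or.inl ⟨x, rfl⟩])
  have hid : U.val.comp (LinearAlgebra.FreeProduct.lift k (fam A B) f) = AlgHom.id k _ := by
    rw [LinearAlgebra.FreeProduct.lift_unique k (fam A B)
        (fun {b} => LinearAlgebra.FreeProduct.ι k (fam A B) b) (AlgHom.id k _)
        fun b => AlgHom.id_comp _]
    refine LinearAlgebra.FreeProduct.lift_unique k (fam A B) _ _ fun b => ?_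
    rw [AlgHom.comp_assoc, LinearAlgebra.FreeProduct.lift_comp_ι]
    rfl
  refine eq_top_iff.2 fun x _ => ?_
  have := DFunLike.congr_fun hid x
  rw [AlgHom.id_apply] at this
  rw [← this]
  exact Subtype.prop _

theorem Algebra.adjoin_range_comp_single {R A : Type*} [CommSemiring R] [Semiring A] [Algebra R A]
    {n : Type*} [Fintype n] [DecidableEq n] (f : (n → R) →ₐ[R] A) :
    Set.range f ⊆ Algebra.adjoin R (Set.range fun i => f (Pi.single i 1)) := by
  rintro _ ⟨x, rfl⟩
  rw [pi_eq_sum_univ' x, map_sum]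
  refine sum_mem fun i _ => ?_
  rw [map_smul]
  refine Subalgebra.smul_mem _ (Algebra.subset_adjoin (Set.mem_range.2 ⟨i, ?_⟩)) _
  exact congrArg f (by ext j; simp [Pi.single_apply, eq_comm])

theorem adjoin_pgen_qgen (k : Type) [Field k] :
    Algebra.adjoin (Ffield k) (Set.range (pgen k) ∪ Set.range (qgen k)) = ⊤ := by
  rw [← top_le_iff, ← FP.adjoin_range_eq_top]
  refine Algebra.adjoin_le (Set.union_subset ?_ ?_)
  · exact (Algebra.adjoin_range_comp_single _).trans
      (Algebra.adjoin_mono Set.subset_union_left)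
  · exact (Algebra.adjoin_range_comp_single _).trans
      (Algebra.adjoin_mono Set.subset_union_right)

/-- The coefficients of `Xrel`, padded by zeros. -/
def relCoeff {R : Type*} [Ring R] (y : Fin 3 → R) : Fin 3 → Fin 3 → R :=
  ![![1, y 0, 0], ![y 1, y 2, 0], ![0, 0, 0]]

theorem map_relCoeff {R R' : Type*} [Ring R] [Ring R'] (f : R →+* R') (y : Fin 3 → R)
    (i j : Fin 3) : f (relCoeff y i j) = relCoeff (f ∘ y) i j := by
  fin_cases i <;> fin_cases j <;> simp [relCoeff]

theorem map_alternatingDiff_relCoeff {R R' : Type*} [Ring R] [Ring R'] (f : R →+* R')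
    (y : Fin 3 → R) (i j : Fin 3) :
    f (alternatingDiff (relCoeff y) i j) = alternatingDiff (relCoeff (f ∘ y)) i j := by
  simp only [alternatingDiff, map_sub, map_relCoeff]

theorem map_quarticForm_relCoeff {R R' : Type*} [CommRing R] [CommRing R'] (f : R →+* R')
    (y : Fin 3 → R) (j : Fin 3) :
    f (quarticForm (alternatingDiff (relCoeff y)) j) =
      quarticForm (alternatingDiff (relCoeff (f ∘ y))) j := by
  simp only [quarticForm, map_sum, map_mul, map_alternatingDiff_relCoeff]

theorem ne_zero_of_eval_ne_zero {k : Type} [Field k] (c : Fin 3 → k)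
    {P : MvPolynomial (Fin 3) k} (h : MvPolynomial.eval c P ≠ 0) :
    algebraMap (MvPolynomial (Fin 3) k) (Ffield k) P ≠ 0 := by
  rw [Ne, FaithfulSMul.algebraMap_eq_zero_iff]
  rintro rfl
  exact h (map_zero _)

theorem eval_comp_X {k : Type} [Field k] (c : Fin 3 → k) :
    MvPolynomial.eval c ∘ MvPolynomial.X = c := by
  ext i; simp

theorem alternatingDiff_yvar_ne_zero (k : Type) [Field k] [CharZero k] (i j : Fin 3) :
    alternatingDiff (relCoeff (yvar k)) i j ≠ 0 := by
  have h := map_alternatingDiff_relCoeff (algebraMap (MvPolynomial (Fin 3) k) (Ffield k))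
    MvPolynomial.X i j
  change _ = alternatingDiff (relCoeff (yvar k)) i j at h
  rw [← h]
  refine ne_zero_of_eval_ne_zero (Int.castRingHom k ∘ ![2, 3, 5]) ?_
  rw [map_alternatingDiff_relCoeff, eval_comp_X, ← map_alternatingDiff_relCoeff]
  refine Int.cast_ne_zero.2 ?_
  clear h
  revert i j
  decide

theorem quarticForm_yvar_ne_zero (k : Type) [Field k] [CharZero k] (j : Fin 3) :
    quarticForm (alternatingDiff (relCoeff (yvar k))) j ≠ 0 := by
  have h := map_quarticForm_relCoeff (algebraMap (MvPolynomial (Fin 3) k) (Ffield k))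
    MvPolynomial.X j
  change _ = quarticForm (alternatingDiff (relCoeff (yvar k))) j at h
  rw [← h]
  refine ne_zero_of_eval_ne_zero (Int.castRingHom k ∘ ![2, 3, 5]) ?_
  rw [map_quarticForm_relCoeff, eval_comp_X, ← map_quarticForm_relCoeff]
  refine Int.cast_ne_zero.2 ?_
  clear h
  revert j
  decide

theorem Xrel_eq_sum (k : Type) [Field k] :
    Xrel k = ∑ i, ∑ j, relCoeff (yvar k) i j •
      (pgen k i * qgen k j - qgen k j * pgen k i) := by
  simp [Xrel, relCoeff, Fin.sum_univ_three, add_assoc]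

theorem statement4 (k : Type) [Field k] [IsAlgClosed k] [CharZero k] :
    Module.Finite (Ffield k) (Salg k) ∧ Module.finrank (Ffield k) (Salg k) ≤ 19 := by
  let π : FP (Ffield k) (Fin 3 → Ffield k) (Fin 3 → Ffield k) →ₐ[Ffield k] Salg k :=
    RingQuot.mkAlgHom (Ffield k) _
  have hπ : Function.Surjective π := RingQuot.mkAlgHom_surjective _ _
  have hp : CompleteOrthogonalIdempotents (π ∘ pgen k) :=
    ((CompleteOrthogonalIdempotents.single fun _ : Fin 3 => Ffield k).map
      (inl (Ffield k) (Fin 3 → Ffield k) (Fin 3 → Ffield k)).toRingHom).map π.toRingHom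
  have hq : CompleteOrthogonalIdempotents (π ∘ qgen k) :=
    ((CompleteOrthogonalIdempotents.single fun _ : Fin 3 => Ffield k).map
      (inr (Ffield k) (Fin 3 → Ffield k) (Fin 3 → Ffield k)).toRingHom).map π.toRingHom
  have hX : ∑ i, ∑ j, relCoeff (yvar k) i j •
      ((π ∘ pgen k) i * (π ∘ qgen k) j - (π ∘ qgen k) j * (π ∘ pgen k) i) = 0 := by
    have h : π (Xrel k) = π 0 := RingQuot.mkAlgHom_rel _ ⟨rfl, rfl⟩
    have h' := (congrArg π (Xrel_eq_sum k)).symm.trans (h.trans (map_zero π))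
    have hsub : ∀ x y, π (x - y) = π x - π y := fun x y => map_sub π x y
    simp only [map_sum, map_smul, hsub, map_mul] at h'
    exact h'
  have hgen : Algebra.adjoin (Ffield k) (Set.range (π ∘ pgen k) ∪ Set.range (π ∘ qgen k)) = ⊤ := by
    rw [Set.range_comp, Set.range_comp, ← Set.image_union, ← AlgHom.map_adjoin,
      adjoin_pgen_qgen, Algebra.map_top, AlgHom.range_eq_top]
    exact hπ
  have h := finite_and_finrank_le hp hq hX (alternatingDiff_yvar_ne_zero k)
    (quarticForm_yvar_ne_zero k) hgen
  exact ⟨h.1, h.2.trans (by norm_num)⟩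
end
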